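/- For all r ≥ k ≥ 3 the asymptotic codegree tiling threshold for the k-uniform clique on r vertices satisfies t_{k-1}(K^{(k)}_r) ≤ 1 - 1/(C(r-1,k-1) + C(r-2,k-2)). Concretely: for every α > 0 there is n₀ such that for all n ≥ n₀ divisible by r, every k-graph H on n vertices with minimum codegree δ(H) ≥ (1 - 1/(C(r-1,k-1)+C(r-2,k-2)) + α)·n contains a perfect matching by r-cliques (a partition of V(H) into n/r sets of size r, each spanning a clique). -/

import Mathlib

open Finset
open scoped Classical

/-- `S` spans a clique in the `k`-graph with edge set `H`. -/
def HIsClique {V : Type*} (H : Finset (Finset V)) (k : ℕ) (S : Finset V) : Prop :=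
  ∀ e : Finset V, e ⊆ S → e.card = k → e ∈ H

lemma chernoff_count (b c : ℝ) (hb : 0 ≤ b) (hbc : b < c) :
    ∃ ρ : ℝ, 0 < ρ ∧ ρ < 1 ∧ ∀ (ι T : Type) [Fintype ι] [DecidableEq ι] [Fintype T] (Z : T → ℝ),
      (∀ τ, 0 ≤ Z τ) → (∀ τ, Z τ ≤ 1) → ∑ τ, Z τ ≤ b * Fintype.card T →
      ((univ.filter (fun f : ι → T => c * Fintype.card ι ≤ ∑ i, Z (f i))).card : ℝ)
        ≤ ρ ^ Fintype.card ι * (Fintype.card T : ℝ) ^ Fintype.card ι := by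
  obtain ⟨y, hy1, hyb⟩ : ∃ y : ℝ, 1 < y ∧ y * b < c := by
    refine ⟨1 + (c - b) / (2 * (b + 1)), ?_, ?_⟩
    · have : 0 < (c - b) / (2 * (b + 1)) := div_pos (by linarith) (by linarith)
      linarith
    · have : (c - b) / (2 * (b + 1)) * b < c - b := by
        rw [div_mul_eq_mul_div, div_lt_iff₀ (by linarith)]
        nlinarith
      linarith
  have hy0 : 0 < y := by linarith
  have hyc : 0 < y ^ c := Real.rpow_pos_of_pos hy0 c
  have h1 : 0 < 1 + (y - 1) * b := by nlinarith
  have hlt : 1 + (y - 1) * b < y ^ c := by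
    have e1 : 1 + (y - 1) * b ≤ Real.exp ((y - 1) * b) := by
      have := Real.add_one_le_exp ((y - 1) * b); linarith
    refine lt_of_le_of_lt e1 ?_
    rw [Real.rpow_def_of_pos hy0]
    apply Real.exp_lt_exp.2
    have e2 : 1 - y⁻¹ ≤ Real.log y := Real.one_sub_inv_le_log_of_pos hy0
    have hc : 0 < c := by linarith
    have e3 : (y - 1) * b < (1 - y⁻¹) * c := by
      have : 1 - y⁻¹ = (y - 1) / y := by field_simp
      rw [this, div_mul_eq_mul_div, lt_div_iff₀ hy0]
      nlinarith
    nlinarith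
  refine ⟨(1 + (y - 1) * b) / y ^ c, by positivity, (div_lt_one hyc).2 hlt, ?_⟩
  intro ι T _ _ _ Z hZ0 hZ1 hZ
  have key : ∑ f : ι → T, ∏ i, y ^ (Z (f i)) = (∑ τ, y ^ (Z τ)) ^ Fintype.card ι := by
    rw [← Finset.card_univ, ← Finset.prod_const, Finset.prod_univ_sum]
    simp
  have hS : ∑ τ, y ^ (Z τ) ≤ (1 + (y - 1) * b) * Fintype.card T := by
    calc ∑ τ, y ^ (Z τ) ≤ ∑ τ : T, (1 + Z τ * (y - 1)) := by
          apply Finset.sum_le_sum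
          intro τ _
          have := rpow_one_add_le_one_add_mul_self (s := y - 1) (by linarith) (hZ0 τ) (hZ1 τ)
          simpa using this
      _ = Fintype.card T + (∑ τ, Z τ) * (y - 1) := by
          rw [Finset.sum_add_distrib, Finset.sum_mul]; simp
      _ ≤ _ := by nlinarith
  have hS0 : 0 ≤ ∑ τ, y ^ (Z τ) := Finset.sum_nonneg (fun τ _ => (Real.rpow_pos_of_pos hy0 _).le)
  have h2 : ((univ.filter (fun f : ι → T => c * Fintype.card ι ≤ ∑ i, Z (f i))).card : ℝ)
      * (y ^ c) ^ Fintype.card ι ≤ ∑ f : ι → T, ∏ i, y ^ (Z (f i)) := by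
    rw [← nsmul_eq_mul]
    refine le_trans (Finset.card_nsmul_le_sum _ (fun f : ι → T => ∏ i, y ^ (Z (f i))) _ ?_)
      (Finset.sum_le_sum_of_subset_of_nonneg (Finset.filter_subset _ _) ?_)
    · intro f hf
      rw [Finset.mem_filter] at hf
      rw [← Real.rpow_sum_of_pos hy0, ← Real.rpow_natCast, ← Real.rpow_mul hy0.le]
      exact Real.rpow_le_rpow_of_exponent_le hy1.le hf.2
    · intro f _ _
      exact Finset.prod_nonneg (fun i _ => (Real.rpow_pos_of_pos hy0 _).le)
  rw [key] at h2
  rw [div_pow, div_mul_eq_mul_div, le_div_iff₀ (by positivity), ← mul_pow]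
  exact h2.trans (pow_le_pow_left₀ hS0 hS _)

lemma card_eval_eq {ι V : Type} [Fintype ι] [DecidableEq ι] [Fintype V] (i : ι) (v : V) :
    (univ.filter (fun g : ι → V => g i = v)).card * Fintype.card V
      ≤ Fintype.card V ^ Fintype.card ι := by
  rw [← Finset.card_univ (α := V), ← Finset.card_product, Finset.card_univ (α := V),
    ← Fintype.card_fun, ← Finset.card_univ]
  apply Finset.card_le_card_of_injOn (fun p => Function.update p.1 i p.2)
  · intro _ _; simp
  · rintro ⟨g, u⟩ hg ⟨g', u'⟩ hg' h
    simp only [Finset.coe_product, Set.mem_prod, Finset.mem_coe, Finset.mem_filter,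
      Finset.mem_univ, true_and, and_true] at hg hg'
    have hu : u = u' := by simpa using congrFun h i
    have hgg : g = g' := by
      funext j
      by_cases hj : j = i
      · subst hj; rw [hg, hg']
      · simpa [hj] using congrFun h j
    rw [hu, hgg]

lemma card_eval_eq_eval {ι V : Type} [Fintype ι] [DecidableEq ι] [Fintype V] (i j : ι) (hij : i ≠ j) :
    (univ.filter (fun g : ι → V => g i = g j)).card * Fintype.card V
      ≤ Fintype.card V ^ Fintype.card ι := by
  rw [← Finset.card_univ (α := V), ← Finset.card_product, Finset.card_univ (α := V),
    ← Fintype.card_fun, ← Finset.card_univ]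
  apply Finset.card_le_card_of_injOn (fun p => Function.update p.1 i p.2)
  · intro _ _; simp
  · rintro ⟨g, u⟩ hg ⟨g', u'⟩ hg' h
    simp only [Finset.coe_product, Set.mem_prod, Finset.mem_coe, Finset.mem_filter,
      Finset.mem_univ, true_and, and_true] at hg hg'
    have hu : u = u' := by simpa using congrFun h i
    have hgg : g = g' := by
      funext l
      by_cases hj : l = i
      · subst hj; rw [hg, hg']
        simpa [hij.symm] using congrFun h j
      · simpa [hj] using congrFun h l
    rw [hu, hgg]

lemma card_noninj {ι V : Type} [Fintype ι] [DecidableEq ι] [Fintype V] :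
    (univ.filter (fun g : ι → V => ¬ Function.Injective g)).card * Fintype.card V
      ≤ Fintype.card ι ^ 2 * Fintype.card V ^ Fintype.card ι := by
  have hsub : univ.filter (fun g : ι → V => ¬ Function.Injective g) ⊆
      ((univ : Finset (ι × ι)).filter (fun p => p.1 ≠ p.2)).biUnion
        (fun p => univ.filter (fun g : ι → V => g p.1 = g p.2)) := by
    intro g hg
    have hg' := (Finset.mem_filter.1 hg).2
    rw [Function.Injective] at hg'
    push Not at hg'
    obtain ⟨a, b, hab, hne⟩ := hg'
    simp only [Finset.mem_biUnion, Finset.mem_filter, Finset.mem_univ, true_and]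
    exact ⟨(a, b), hne, hab⟩
  calc _ ≤ (∑ p ∈ (univ : Finset (ι × ι)).filter (fun p => p.1 ≠ p.2),
        (univ.filter (fun g : ι → V => g p.1 = g p.2)).card) * Fintype.card V :=
        Nat.mul_le_mul_right _ ((Finset.card_le_card hsub).trans Finset.card_biUnion_le)
    _ = ∑ p ∈ (univ : Finset (ι × ι)).filter (fun p => p.1 ≠ p.2),
        (univ.filter (fun g : ι → V => g p.1 = g p.2)).card * Fintype.card V := Finset.sum_mul _ _ _
    _ ≤ ∑ p ∈ (univ : Finset (ι × ι)).filter (fun p => p.1 ≠ p.2),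
        Fintype.card V ^ Fintype.card ι := by
        apply Finset.sum_le_sum
        intro p hp
        exact card_eval_eq_eval _ _ (Finset.mem_filter.1 hp).2
    _ ≤ _ := by
        rw [Finset.sum_const, smul_eq_mul]
        apply Nat.mul_le_mul_right
        refine (Finset.card_filter_le _ _).trans ?_
        simp [sq]

/-- functions hitting a set -/
lemma card_hit {ι V : Type} [Fintype ι] [DecidableEq ι] [Fintype V] (U : Finset V) :
    (univ.filter (fun g : ι → V => ∃ i, g i ∈ U)).card * Fintype.card V
      ≤ Fintype.card ι * U.card * Fintype.card V ^ Fintype.card ι := by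
  have hsub : univ.filter (fun g : ι → V => ∃ i, g i ∈ U) ⊆
      ((univ : Finset ι) ×ˢ U).biUnion
        (fun p => univ.filter (fun g : ι → V => g p.1 = p.2)) := by
    intro g hg
    simp only [Finset.mem_filter, Finset.mem_univ, true_and] at hg
    obtain ⟨i, hi⟩ := hg
    simp only [Finset.mem_biUnion, Finset.mem_filter, Finset.mem_univ, true_and]
    exact ⟨(i, g i), by simpa using hi, rfl⟩
  calc _ ≤ (∑ p ∈ (univ : Finset ι) ×ˢ U,
        (univ.filter (fun g : ι → V => g p.1 = p.2)).card) * Fintype.card V :=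
        Nat.mul_le_mul_right _ ((Finset.card_le_card hsub).trans Finset.card_biUnion_le)
    _ = ∑ p ∈ (univ : Finset ι) ×ˢ U,
        (univ.filter (fun g : ι → V => g p.1 = p.2)).card * Fintype.card V := Finset.sum_mul _ _ _
    _ ≤ ∑ p ∈ (univ : Finset ι) ×ˢ U, Fintype.card V ^ Fintype.card ι := by
        apply Finset.sum_le_sum
        intro p hp
        exact card_eval_eq _ _
    _ ≤ _ := by
        rw [Finset.sum_const, smul_eq_mul]
        simp

lemma box_theorem (N : ℕ) (hN : 1 ≤ N) (m : ℕ) : ∀ (c : ℝ), 0 < c →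
    ∃ t₀ : ℕ, ∀ (T : Type) [Fintype T], t₀ ≤ Fintype.card T → ∀ A : Finset (Fin m → T),
      c * (Fintype.card T : ℝ) ^ m ≤ A.card →
      ∃ B : Fin m → Finset T, (∀ i, (B i).card = N) ∧ ∀ f, (∀ i, f i ∈ B i) → f ∈ A := by
  induction m with
  | zero =>
    intro c hc
    refine ⟨0, fun T _ _ A hA => ⟨fun i => i.elim0, fun i => i.elim0, fun f _ => ?_⟩⟩
    have : 0 < A.card := by
      have : (0:ℝ) < A.card := lt_of_lt_of_le (by simpa using hc) hA
      exact_mod_cast this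
    obtain ⟨g, hg⟩ := Finset.card_pos.1 this
    rwa [Subsingleton.elim f g]
  | succ m ih =>
    intro c hc
    obtain ⟨t₁, ht₁⟩ := ih (c ^ N / 4) (by positivity)
    obtain ⟨t₂, ht₂⟩ := exists_nat_gt ((N : ℝ) ^ 2 * 4 / c ^ N)
    refine ⟨t₁ + t₂ + 1, fun T _ hT A hA => ?_⟩
    set t : ℝ := (Fintype.card T : ℝ) with ht
    have htpos : 0 < t := by
      have : 0 < Fintype.card T := by omega
      simpa [ht] using this
    have htN : (N : ℝ) ^ 2 ≤ c ^ N / 4 * t := by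
      have h1 : (t₂ : ℝ) ≤ t := by rw [ht]; exact_mod_cast (by omega)
      have h2 : (N : ℝ) ^ 2 * 4 / c ^ N < t := lt_of_lt_of_le ht₂ h1
      rw [div_lt_iff₀ (by positivity)] at h2
      linarith
    let d : (Fin m → T) → Finset T := fun g => univ.filter (fun x => (Fin.cons x g : Fin (m+1) → T) ∈ A)
    let C : (Fin N → T) → Finset (Fin m → T) :=
      fun p => univ.filter (fun g => ∀ i, (Fin.cons (p i) g : Fin (m+1) → T) ∈ A)
    have hAd : A.card = ∑ g, (d g).card := by
      rw [Finset.card_eq_sum_card_fiberwise (f := fun f : Fin (m+1) → T => Fin.tail f) 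
        (t := (univ : Finset (Fin m → T))) (by intro _ _; exact Finset.mem_coe.2 (Finset.mem_univ _))]
      refine Finset.sum_congr rfl (fun g _ => ?_)
      refine Finset.card_bij' (fun f _ => f 0) (fun x _ => Fin.cons x g) ?_ ?_ ?_ ?_
      · intro f hf
        obtain ⟨h1, h2⟩ := Finset.mem_filter.1 hf
        refine Finset.mem_filter.2 ⟨Finset.mem_univ _, ?_⟩
        rw [← h2, Fin.cons_self_tail]; exact h1
      · intro x hx
        have hx' := (Finset.mem_filter.1 hx).2
        exact Finset.mem_filter.2 ⟨hx', by simp⟩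
      · intro f hf
        obtain ⟨h1, h2⟩ := Finset.mem_filter.1 hf
        rw [← h2, Fin.cons_self_tail]
      · intro x hx; simp
    have hdc : ∑ p, (C p).card = ∑ g, (d g).card ^ N := by
      have e1 : ∀ p, (C p).card = ∑ g, if (∀ i, (Fin.cons (p i) g : Fin (m+1) → T) ∈ A) then 1 else 0 := by
        intro p; simp [C]
      have e2 : ∀ g, (d g).card ^ N = ∑ p : Fin N → T, if (∀ i, (Fin.cons (p i) g : Fin (m+1) → T) ∈ A) then 1 else 0 := by
        intro g
        have : (Fintype.piFinset (fun _ : Fin N => d g)).card = (d g).card ^ N := by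
          simp [Fintype.card_piFinset]
        rw [← this, Finset.sum_boole]
        simp only [Nat.cast_id]
        congr 1
        ext p
        simp [d, Fintype.mem_piFinset]
      rw [Finset.sum_congr rfl (fun p _ => e1 p), Finset.sum_congr rfl (fun g _ => e2 g),
        Finset.sum_comm]
    have hpm : c ^ N * (t ^ N * t ^ m) ≤ ∑ p, ((C p).card : ℝ) := by
      have e0 : ∑ p, ((C p).card : ℝ) = ∑ g, ((d g).card : ℝ) ^ N := by exact_mod_cast hdc
      rw [e0]
      obtain ⟨N', rfl⟩ : ∃ N', N = N' + 1 := ⟨N - 1, by omega⟩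
      have := pow_sum_div_card_le_sum_pow (s := (univ : Finset (Fin m → T)))
        (f := fun g => ((d g).card : ℝ)) (fun _ _ => by positivity) N'
      refine le_trans ?_ this
      have hs : (∑ g, ((d g).card : ℝ)) = A.card := by rw [hAd]; push_cast; rfl
      rw [hs]
      have hcu : ((univ : Finset (Fin m → T)).card : ℝ) = t ^ m := by
        rw [Finset.card_univ, Fintype.card_fun]; simp [ht]
      rw [hcu, le_div_iff₀ (by positivity)]
      calc c ^ (N'+1) * (t ^ (N'+1) * t ^ m) * (t ^ m) ^ N' = (c * t ^ (m+1)) ^ (N'+1) := by ring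
        _ ≤ _ := pow_le_pow_left₀ (by positivity) hA _
    have hex : ∃ p : Fin N → T, Function.Injective p ∧ c ^ N / 4 * t ^ m ≤ (C p).card := by
      by_contra hcon
      push Not at hcon
      have hsplit := Finset.sum_filter_add_sum_filter_not univ
        (fun p : Fin N → T => Function.Injective p) (fun p => ((C p).card : ℝ))
      have hcF : (Fintype.card (Fin N → T) : ℝ) = t ^ N := by
        rw [Fintype.card_fun]; simp [ht]
      have b1 : ∑ p ∈ univ.filter (fun p : Fin N → T => Function.Injective p), ((C p).card : ℝ)
          ≤ t ^ N * (c ^ N / 4 * t ^ m) := by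
        refine (Finset.sum_le_card_nsmul _ _ (c ^ N / 4 * t ^ m) ?_).trans ?_
        · intro p hp
          exact (hcon p (Finset.mem_filter.1 hp).2).le
        · rw [nsmul_eq_mul]
          apply mul_le_mul_of_nonneg_right _ (by positivity)
          rw [← hcF]
          exact_mod_cast Finset.card_le_univ _
      have b2 : ∑ p ∈ univ.filter (fun p : Fin N → T => ¬ Function.Injective p), ((C p).card : ℝ)
          ≤ (c ^ N / 4 * t ^ N) * t ^ m := by
        refine (Finset.sum_le_card_nsmul _ _ (t ^ m) ?_).trans ?_
        · intro p hp
          have : ((univ : Finset (Fin m → T)).card : ℝ) = t ^ m := by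
            rw [Finset.card_univ, Fintype.card_fun]; simp [ht]
          rw [← this]
          exact_mod_cast Finset.card_le_univ _
        · rw [nsmul_eq_mul]
          apply mul_le_mul_of_nonneg_right _ (by positivity)
          have h := card_noninj (ι := Fin N) (V := T)
          have h' : ((univ.filter (fun p : Fin N → T => ¬ Function.Injective p)).card : ℝ) * t
              ≤ (N:ℝ) ^ 2 * t ^ N := by
            rw [ht]; simp only [Fintype.card_fin] at h; exact_mod_cast h
          have h'' : ((univ.filter (fun p : Fin N → T => ¬ Function.Injective p)).card : ℝ) * t
              ≤ (c ^ N / 4 * t ^ N) * t := by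
            refine h'.trans ?_
            calc (N:ℝ) ^ 2 * t ^ N ≤ (c ^ N / 4 * t) * t ^ N :=
                  mul_le_mul_of_nonneg_right htN (by positivity)
              _ = _ := by ring
          exact le_of_mul_le_mul_right h'' htpos
      have hpos : 0 < c ^ N * (t ^ N * t ^ m) := by positivity
      nlinarith
    obtain ⟨p, hp, hCp⟩ := hex
    obtain ⟨B, hB1, hB2⟩ := ht₁ T (by omega) (C p) hCp
    refine ⟨Fin.cons (univ.image p) B, ?_, ?_⟩
    · intro i
      refine Fin.cases ?_ (fun j => ?_) i
      · simp [Finset.card_image_of_injective _ hp]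
      · simpa using hB1 j
    · intro f hf
      have h0 := hf 0
      simp only [Fin.cons_zero, Finset.mem_image, Finset.mem_univ, true_and] at h0
      obtain ⟨i, hi⟩ := h0
      have ht' : Fin.tail f ∈ C p := by
        apply hB2
        intro j
        have := hf j.succ
        simpa [Fin.tail] using this
      have := (Finset.mem_filter.1 ht').2 i
      rw [hi, Fin.cons_self_tail] at this
      exact this

lemma selection_step {ι V R : Type} [Fintype ι] [DecidableEq ι] [Nonempty ι] [Fintype V] (c β : ℝ) (hc : 0 < c)
    (hc1 : c ≤ 1) (hn : 0 < Fintype.card V)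
    (hβ : (Fintype.card ι : ℝ) ^ 2 * β ≤ c / 2) (Req : Finset R) (hReq : Req.Nonempty)
    (A : R → Finset (ι → V))
    (hA : ∀ q ∈ Req, c * (Fintype.card V : ℝ) ^ Fintype.card ι ≤ (A q).card) (s : ℕ) :
    (s : ℝ) ≤ β * Fintype.card V →
    ∃ F : Finset (ι → V), F.card = s ∧
      (∀ g ∈ F, ∃ q ∈ Req, g ∈ A q) ∧
      (∀ g ∈ F, ∀ g' ∈ F, g ≠ g' → Disjoint (univ.image g) (univ.image g')) ∧
      ∑ q ∈ Req, (1/2 : ℝ) ^ (F.filter (fun g => g ∈ A q)).card ≤ (1 - c / 4) ^ s * Req.card := by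
  set n : ℝ := (Fintype.card V : ℝ) with hndef
  set L := Fintype.card ι with hL
  have hnpos : 0 < n := by rw [hndef]; exact_mod_cast hn
  induction s with
  | zero =>
    intro _
    exact ⟨∅, by simp, by simp, by simp, by simp⟩
  | succ s ih =>
    intro hs
    push_cast at hs
    obtain ⟨F, hFc, hFA, hFd, hFs⟩ := ih (by linarith)
    let U : Finset V := F.biUnion (fun g => univ.image g)
    have hUc : (U.card : ℝ) ≤ s * L := by
      have : U.card ≤ F.card * L := by
        refine Finset.card_biUnion_le_card_mul _ _ _ (fun g _ => ?_)
        exact Finset.card_image_le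
      rw [hFc] at this
      exact_mod_cast this
    let hit := univ.filter (fun g : ι → V => ∃ i, g i ∈ U)
    have hhit : (hit.card : ℝ) ≤ c / 2 * n ^ L := by
      have h := card_hit (ι := ι) U
      have h' : (hit.card : ℝ) * n ≤ L * U.card * n ^ L := by
        rw [hndef]; exact_mod_cast h
      have h2 : (L : ℝ) * U.card ≤ c / 2 * n := by
        have hL0 : (0:ℝ) ≤ L := by positivity
        calc (L : ℝ) * U.card ≤ L * (s * L) := by gcongr
          _ = (L:ℝ) ^ 2 * s := by ring
          _ ≤ (L:ℝ) ^ 2 * (β * n) := by gcongr; linarith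
          _ = ((L:ℝ) ^ 2 * β) * n := by ring
          _ ≤ _ := by gcongr
      have h3 : (hit.card : ℝ) * n ≤ (c / 2 * n ^ L) * n := by
        refine h'.trans ?_
        calc (L : ℝ) * U.card * n ^ L ≤ (c / 2 * n) * n ^ L := by gcongr
          _ = _ := by ring
      exact le_of_mul_le_mul_right h3 hnpos
    let av := (Req.biUnion A) \ hit
    have hAv : ∀ q ∈ Req, c / 2 * n ^ L ≤ ((av.filter (fun g => g ∈ A q)).card : ℝ) := by
      intro q hq
      have hsub : A q \ hit ⊆ av.filter (fun g => g ∈ A q) := by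
        intro g hg
        rw [Finset.mem_sdiff] at hg
        simp only [av, Finset.mem_filter, Finset.mem_sdiff, Finset.mem_biUnion]
        exact ⟨⟨⟨q, hq, hg.1⟩, hg.2⟩, hg.1⟩
      have h1 : (A q).card ≤ (A q \ hit).card + hit.card := by
        have := Finset.le_card_sdiff hit (A q)
        omega
      have h2 : ((A q).card : ℝ) ≤ (av.filter (fun g => g ∈ A q)).card + hit.card := by
        exact_mod_cast h1.trans (Nat.add_le_add_right (Finset.card_le_card hsub) _)
      have := hA q hq
      linarith
    have havn : (av.card : ℝ) ≤ n ^ L := by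
      have : av.card ≤ Fintype.card (ι → V) := Finset.card_le_univ _
      rw [Fintype.card_fun] at this
      rw [hndef]; exact_mod_cast this
    have havne : av.Nonempty := by
      obtain ⟨q, hq⟩ := hReq
      have h1 := hAv q hq
      have h2 : (0:ℝ) < (av.filter (fun g => g ∈ A q)).card := lt_of_lt_of_le (by positivity) h1
      have h3 : 0 < (av.filter (fun g => g ∈ A q)).card := by exact_mod_cast h2
      obtain ⟨g, hg⟩ := Finset.card_pos.1 h3
      exact ⟨g, (Finset.mem_filter.1 hg).1⟩
    set Φ : ℝ := ∑ q ∈ Req, (1/2 : ℝ) ^ (F.filter (fun g => g ∈ A q)).card with hΦ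
    have hΦ0 : 0 ≤ Φ := Finset.sum_nonneg (fun _ _ => by positivity)
    have hsum : ∑ g ∈ av, ∑ q ∈ Req, (1/2 : ℝ) ^ (F.filter (fun g => g ∈ A q)).card *
        (if g ∈ A q then 1/2 else 1) ≤ ∑ g ∈ av, (1 - c / 4) * Φ := by
      rw [Finset.sum_comm, Finset.sum_const, nsmul_eq_mul]
      have : ∀ q ∈ Req, ∑ g ∈ av, (1/2 : ℝ) ^ (F.filter (fun g => g ∈ A q)).card *
        (if g ∈ A q then 1/2 else 1) ≤ (1/2 : ℝ) ^ (F.filter (fun g => g ∈ A q)).card *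
          (av.card * (1 - c / 4)) := by
        intro q hq
        rw [← Finset.mul_sum]
        apply mul_le_mul_of_nonneg_left _ (by positivity)
        have e : ∀ g, (if g ∈ A q then (1/2 : ℝ) else 1) = 1 - (1/2) * (if g ∈ A q then 1 else 0) := by
          intro g; split_ifs <;> norm_num
        simp_rw [e]
        rw [Finset.sum_sub_distrib, ← Finset.mul_sum, Finset.sum_boole]
        simp only [Finset.sum_const, nsmul_eq_mul, mul_one]
        have := hAv q hq
        nlinarith
      refine (Finset.sum_le_sum this).trans ?_
      rw [← Finset.sum_mul]
      apply le_of_eq; ring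
    obtain ⟨g, hgav, hg⟩ := Finset.exists_le_of_sum_le havne hsum
    have hgU : ∀ i, g i ∉ U := by
      intro i hi
      have := (Finset.mem_sdiff.1 hgav).2
      apply this
      simp only [hit, Finset.mem_filter, Finset.mem_univ, true_and]
      exact ⟨i, hi⟩
    have hdis : ∀ g' ∈ F, Disjoint (univ.image g) (univ.image g') := by
      intro g' hg'
      rw [Finset.disjoint_left]
      intro v hv hv'
      obtain ⟨i, -, rfl⟩ := Finset.mem_image.1 hv
      exact hgU i (Finset.mem_biUnion.2 ⟨g', hg', hv'⟩)
    have hgF : g ∉ F := by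
      intro h
      obtain ⟨i⟩ := ‹Nonempty ι›
      exact hgU i (Finset.mem_biUnion.2 ⟨g, h, Finset.mem_image_of_mem _ (Finset.mem_univ _)⟩)
    refine ⟨insert g F, by rw [Finset.card_insert_of_notMem hgF, hFc], ?_, ?_, ?_⟩
    · intro g' hg'
      rcases Finset.mem_insert.1 hg' with rfl | h
      · have := (Finset.mem_sdiff.1 hgav).1
        simpa using this
      · exact hFA g' h
    · intro a ha b hb hab
      rcases Finset.mem_insert.1 ha with rfl | ha' <;> rcases Finset.mem_insert.1 hb with rfl | hb'
      · exact absurd rfl hab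
      · exact hdis b hb'
      · exact (hdis a ha').symm
      · exact hFd a ha' b hb' hab
    · have : ∑ q ∈ Req, (1/2 : ℝ) ^ ((insert g F).filter (fun g => g ∈ A q)).card
          = ∑ q ∈ Req, (1/2 : ℝ) ^ (F.filter (fun g => g ∈ A q)).card *
        (if g ∈ A q then 1/2 else 1) := by
        refine Finset.sum_congr rfl (fun q _ => ?_)
        rw [Finset.filter_insert]
        split_ifs with h
        · rw [Finset.card_insert_of_notMem (by simp [hgF]), pow_succ]
        · simp
      rw [this]
      refine hg.trans ?_
      rw [pow_succ]
      have : 0 ≤ 1 - c / 4 := by linarith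
      nlinarith

lemma selection (L r : ℕ) (c β : ℝ) (hc : 0 < c) (hc1 : c ≤ 1) (hβ0 : 0 < β)
    (hβ : (L : ℝ) ^ 2 * β ≤ c / 2) :
    ∃ n₀ : ℕ, ∀ (ι V R : Type) [Fintype ι] [DecidableEq ι] [Nonempty ι] [Fintype V], Fintype.card ι = L →
    n₀ ≤ Fintype.card V → ∀ (Req : Finset R), Req.Nonempty →
    (Req.card : ℝ) ≤ (Fintype.card V : ℝ) ^ r →
    ∀ (A : R → Finset (ι → V)),
    (∀ q ∈ Req, c * (Fintype.card V : ℝ) ^ L ≤ (A q).card) →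
    ∃ F : Finset (ι → V), (F.card : ℝ) ≤ β * Fintype.card V ∧
      (∀ g ∈ F, ∃ q ∈ Req, g ∈ A q) ∧
      (∀ g ∈ F, ∀ g' ∈ F, g ≠ g' → Disjoint (univ.image g) (univ.image g')) ∧
      ∀ q ∈ Req, c * β / 8 * Fintype.card V ≤ ((F.filter (fun g => g ∈ A q)).card : ℝ) := by
  have hlog := (Real.isLittleO_log_id_atTop.comp_tendsto tendsto_natCast_atTop_atTop).bound
    (show (0:ℝ) < c * β / (16 * (r + 1)) by positivity)
  obtain ⟨n₁, hn₁⟩ := Filter.eventually_atTop.1 hlog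
  obtain ⟨n₂, hn₂⟩ := exists_nat_gt (4 / β)
  refine ⟨n₁ + n₂ + 1, fun ι V R _ _ _ _ hι hV Req hReq hRc A hA => ?_⟩
  subst hι
  have hnpos : 0 < Fintype.card V := by omega
  set n : ℝ := (Fintype.card V : ℝ) with hn
  have hn0 : 0 < n := by rw [hn]; exact_mod_cast hnpos
  have hl := hn₁ (Fintype.card V) (by omega)
  simp only [Function.comp, id, Real.norm_eq_abs] at hl
  rw [← hn, abs_of_pos hn0] at hl
  have hl1 : Real.log n ≤ c * β / (16 * (r + 1)) * n := (le_abs_self _).trans hl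
  have hl2 : r * Real.log n ≤ c * β / 16 * n := by
    have h1 : (r:ℝ) * Real.log n ≤ r * (c * β / (16 * (r + 1)) * n) := by gcongr
    refine h1.trans ?_
    have : (r:ℝ) * (c * β / (16 * (r + 1)) * n) = (r / (r + 1)) * (c * β / 16 * n) := by
      field_simp
    rw [this]
    have h2 : (r:ℝ) / (r + 1) ≤ 1 := by rw [div_le_one (by positivity)]; linarith
    have h3 : 0 ≤ c * β / 16 * n := by positivity
    nlinarith
  have hn4 : 4 ≤ β * n := by
    have h1 : (n₂ : ℝ) ≤ n := by rw [hn]; exact_mod_cast (by omega)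
    have h2 : 4 / β < n := lt_of_lt_of_le hn₂ h1
    rw [div_lt_iff₀ hβ0] at h2
    linarith
  obtain ⟨F, h1, h2, h3, h4⟩ := selection_step c β hc hc1 hnpos hβ Req hReq A hA ⌊β * n⌋₊
    (Nat.floor_le (by positivity))
  refine ⟨F, by rw [h1]; exact Nat.floor_le (by positivity), h2, h3, ?_⟩
  intro q hq
  have h5 : (1/2 : ℝ) ^ (F.filter (fun g => g ∈ A q)).card ≤ (1 - c / 4) ^ ⌊β * n⌋₊ * Req.card :=
    (Finset.single_le_sum (f := fun q => (1/2 : ℝ) ^ (F.filter (fun g => g ∈ A q)).card)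
      (fun _ _ => by positivity) hq).trans h4
  set h := (F.filter (fun g => g ∈ A q)).card with hh
  have hR0 : (0:ℝ) < Req.card := by exact_mod_cast Finset.card_pos.2 hReq
  have h6 := Real.log_le_log (by positivity) h5
  have hc4 : 0 < 1 - c / 4 := by linarith
  rw [Real.log_mul (by positivity) (by positivity), Real.log_pow, Real.log_pow] at h6
  have h7 : Real.log (1 - c / 4) ≤ - (c / 4) := by
    have := Real.log_le_sub_one_of_pos hc4; linarith
  have h8 : Real.log Req.card ≤ r * Real.log n := by
    rw [← Real.log_pow]; exact Real.log_le_log hR0 hRc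
  have h9 : -1 ≤ Real.log (1 / 2) := by
    rw [one_div, Real.log_inv]
    have := Real.log_two_lt_d9
    linarith
  have h10 : β * n - 1 ≤ (⌊β * n⌋₊ : ℝ) := by
    have := Nat.lt_floor_add_one (β * n); linarith
  have hh0 : (0:ℝ) ≤ h := by positivity
  have hf0 : (0:ℝ) ≤ (⌊β * n⌋₊ : ℝ) := by positivity
  have h11 : -(h:ℝ) ≤ h * Real.log (1/2) := by nlinarith
  have h12 : (⌊β * n⌋₊ : ℝ) * Real.log (1 - c / 4) ≤ (⌊β * n⌋₊ : ℝ) * (-(c/4)) := by gcongr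
  have h13 : (3/4 * (β * n)) * (c / 4) ≤ (⌊β * n⌋₊ : ℝ) * (c/4) := by
    gcongr; linarith
  nlinarith

lemma choose_ineq (k r i : ℕ) (hk : 3 ≤ k) (hkr : k ≤ r) (hi : i < r) :
    i.choose (k - 1) * r ≤ i * ((r - 1).choose (k - 1) + (r - 2).choose (k - 2)) := by
  rcases Nat.eq_zero_or_pos i with rfl | hi0
  · rw [Nat.choose_eq_zero_of_lt (by omega)]; simp
  obtain ⟨i', rfl⟩ : ∃ i', i = i' + 1 := ⟨i - 1, by omega⟩
  obtain ⟨k', rfl⟩ : ∃ k', k = k' + 2 := ⟨k - 2, by omega⟩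
  obtain ⟨r', rfl⟩ : ∃ r', r = r' + 2 := ⟨r - 2, by omega⟩
  have h1 := Nat.add_one_mul_choose_eq i' k'
  have h2 := Nat.add_one_mul_choose_eq r' k'
  have h3 : i'.choose k' ≤ r'.choose k' := Nat.choose_le_choose _ (by omega)
  simp only [show k' + 2 - 1 = k' + 1 by omega, show r' + 2 - 1 = r' + 1 by omega,
    Nat.add_sub_cancel]
  have h4 : (k' + 1) * ((i' + 1).choose (k' + 1) * (r' + 2)) ≤
      (k' + 1) * ((i' + 1) * ((r' + 1).choose (k' + 1) + r'.choose k')) := by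
    calc (k' + 1) * ((i' + 1).choose (k' + 1) * (r' + 2))
        = ((i' + 1).choose (k' + 1) * (k' + 1)) * (r' + 2) := by ring
      _ = (i' + 1) * i'.choose k' * (r' + 2) := by rw [← h1]
      _ ≤ (i' + 1) * r'.choose k' * (r' + 1 + (k' + 1)) :=
          Nat.mul_le_mul (Nat.mul_le_mul_left _ h3) (by omega)
      _ = (i' + 1) * ((r' + 1) * r'.choose k' + (k' + 1) * r'.choose k') := by ring
      _ = (i' + 1) * ((r' + 1).choose (k' + 1) * (k' + 1) + (k' + 1) * r'.choose k') := by rw [h2]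
      _ = _ := by ring
  exact Nat.le_of_mul_le_mul_left h4 (by omega)

lemma clique_insert {V : Type} [DecidableEq V] {H : Finset (Finset V)} {k : ℕ} (hk : 1 ≤ k) {S : Finset V} {v : V}
    (hS : HIsClique H k S) (hv : ∀ S' ∈ S.powersetCard (k - 1), insert v S' ∈ H) :
    HIsClique H k (insert v S) := by
  intro e he hc
  by_cases hve : v ∈ e
  · have h1 : e.erase v ∈ S.powersetCard (k - 1) := by
      rw [Finset.mem_powersetCard]
      refine ⟨?_, by rw [Finset.card_erase_of_mem hve, hc]⟩
      rw [← Finset.subset_insert_iff]; exact he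
    have := hv _ h1
    rwa [Finset.insert_erase hve] at this
  · exact hS e ((Finset.subset_insert_iff_of_notMem hve).1 he) hc

lemma clique_small {V : Type} {H : Finset (Finset V)} {k : ℕ} {S : Finset V} (h : S.card < k) :
    HIsClique H k S := by
  intro e he hc
  have := Finset.card_le_card he
  omega

lemma frac_greedy (k r m : ℕ) (hk : 3 ≤ k) (hkr : k ≤ r) (hrm : r ≤ m)
    (Q : Finset (Finset (Fin m × Fin r)))
    (hQc : ∀ e ∈ Q, e.card = k) (hQt : ∀ e ∈ Q, Set.InjOn Prod.fst (e : Set (Fin m × Fin r)))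
    (hdeg : ∀ S : Finset (Fin m × Fin r), S.card = k - 1 →
      Set.InjOn Prod.fst (S : Set (Fin m × Fin r)) →
      (univ.filter (fun v => insert v S ∉ Q)).card *
        ((r - 1).choose (k - 1) + (r - 2).choose (k - 2)) ≤ r * m)
    (a : Fin m × Fin r → ℝ) :
    ∃ e : Finset (Fin m × Fin r), e.card = r ∧ HIsClique Q k e ∧
      m * ∑ v ∈ e, a v ≤ ∑ v, a v := by
  set D := (r - 1).choose (k - 1) + (r - 2).choose (k - 2) with hD
  have hDpos : 0 < D := by
    have : 0 < (r - 1).choose (k - 1) := Nat.choose_pos (by omega)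
    omega
  -- sorting
  obtain ⟨σ, hσ⟩ : ∃ σ : Fin (r * m) ≃ Fin m × Fin r, Monotone (a ∘ σ) := by
    let τ : Fin (r * m) ≃ Fin m × Fin r :=
      (finCongr (Nat.mul_comm r m)).trans finProdFinEquiv.symm
    exact ⟨(Tuple.sort (a ∘ τ)).trans τ, by
      have := Tuple.monotone_sort (a ∘ τ)
      intro x y hxy; exact this hxy⟩
  let A : ℕ → ℝ := fun i => if h : i < r * m then a (σ ⟨i, h⟩) else 0
  have hA : ∀ i (h : i < r * m), A i = a (σ ⟨i, h⟩) := fun i h => dif_pos h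
  have hgreedy : ∀ i ≤ r, ∃ e : Finset (Fin m × Fin r), e.card = i ∧ HIsClique Q k e ∧
      Set.InjOn Prod.fst (e : Set (Fin m × Fin r)) ∧ ∑ v ∈ e, a v ≤ ∑ j ∈ range i, A (j * m) := by
    intro i
    induction i with
    | zero => exact fun _ => ⟨∅, rfl, clique_small (by simp; omega), by simp, by simp⟩
    | succ i ih =>
      intro hi
      obtain ⟨e, hec, heq, het, hes⟩ := ih (by omega)
      obtain ⟨pb, hpb⟩ : ∃ pb : Fin m × Fin r → Prop, ∀ v, pb v ↔ (v.1 ∈ e.image Prod.fst ∨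
        ∃ S ∈ e.powersetCard (k - 1), insert v S ∉ Q) := ⟨_, fun _ => Iff.rfl⟩
      let bad : Finset (Fin m × Fin r) := univ.filter pb
      have hbad : bad.card ≤ i * m := by
        by_cases hik : i < k - 1
        · have hsub : bad ⊆ (e.image Prod.fst) ×ˢ (univ : Finset (Fin r)) := by
            intro v hv
            rcases (hpb v).1 (Finset.mem_filter.1 hv).2 with h | ⟨S, hS, -⟩
            · simpa using h
            · exfalso
              rw [Finset.mem_powersetCard] at hS
              have := Finset.card_le_card hS.1
              omega
          calc bad.card ≤ ((e.image Prod.fst) ×ˢ (univ : Finset (Fin r))).card :=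
                Finset.card_le_card hsub
            _ = (e.image Prod.fst).card * r := by rw [Finset.card_product]; simp
            _ ≤ i * m := by
                apply Nat.mul_le_mul _ hrm
                rw [← hec]; exact Finset.card_image_le
        · have hsub : bad ⊆ (e.powersetCard (k - 1)).biUnion
              (fun S => univ.filter (fun v => insert v S ∉ Q)) := by
            intro v hv
            simp only [Finset.mem_biUnion, Finset.mem_filter, Finset.mem_univ, true_and]
            rcases (hpb v).1 (Finset.mem_filter.1 hv).2 with h | h
            · obtain ⟨p, hp, hpv⟩ := Finset.mem_image.1 h
              obtain ⟨S, hpS, hSe, hSc⟩ := Finset.exists_subsuperset_card_eq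
                (s := {p}) (t := e) (n := k - 1) (by simpa using hp) (by simp; omega) (by omega)
              refine ⟨S, Finset.mem_powersetCard.2 ⟨hSe, hSc⟩, fun hmem => ?_⟩
              have hpS' : p ∈ S := by simpa using hpS
              have : v = p := hQt _ hmem (by simp) (by simp [hpS']) hpv.symm
              subst this
              have := hQc _ hmem
              rw [Finset.insert_eq_of_mem hpS'] at this
              omega
            · exact h
          have h1 : bad.card * D ≤ (i * m) * D := by
            calc bad.card * D ≤ (∑ S ∈ e.powersetCard (k - 1),
                (univ.filter (fun v => insert v S ∉ Q)).card) * D :=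
                  Nat.mul_le_mul_right _ ((Finset.card_le_card hsub).trans Finset.card_biUnion_le)
              _ = ∑ S ∈ e.powersetCard (k - 1),
                (univ.filter (fun v => insert v S ∉ Q)).card * D := Finset.sum_mul _ _ _
              _ ≤ ∑ S ∈ e.powersetCard (k - 1), r * m := by
                  apply Finset.sum_le_sum
                  intro S hS
                  rw [Finset.mem_powersetCard] at hS
                  exact hdeg S hS.2 (het.mono (by exact_mod_cast hS.1))
              _ = (i.choose (k - 1) * r) * m := by
                  rw [Finset.sum_const, Finset.card_powersetCard, hec, smul_eq_mul]; ring
              _ ≤ (i * D) * m := Nat.mul_le_mul_right _ (choose_ineq k r i hk hkr (by omega))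
              _ = _ := by ring
          exact Nat.le_of_mul_le_mul_right h1 hDpos
      have him : i * m < r * m := Nat.mul_lt_mul_of_pos_right (by omega) (by omega)
      have hex : ∃ j ∈ range (i * m + 1), ∃ h : j < r * m, σ ⟨j, h⟩ ∉ bad := by
        by_contra hcon
        push Not at hcon
        have : (range (i * m + 1)).card ≤ bad.card := by
          apply Finset.card_le_card_of_injOn
            (fun j => if h : j < r * m then σ ⟨j, h⟩ else σ ⟨i * m, him⟩)
          · intro j hj
            have hj' := Finset.mem_range.1 (Finset.mem_coe.1 hj)
            have hlt : j < r * m := by omega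
            simp only [hlt, dif_pos]
            exact hcon j (Finset.mem_range.2 hj') hlt
          · intro j hj j' hj' hjj
            have h1 := Finset.mem_range.1 (Finset.mem_coe.1 hj)
            have h2 := Finset.mem_range.1 (Finset.mem_coe.1 hj')
            have h1' : j < r * m := by omega
            have h2' : j' < r * m := by omega
            simp only [h1', h2', dif_pos] at hjj
            have := σ.injective hjj
            simpa using this
        rw [Finset.card_range] at this
        omega
      obtain ⟨j, hj, hjr, hjb⟩ := hex
      set v := σ ⟨j, hjr⟩ with hv
      have hjb' : ¬ (v.1 ∈ e.image Prod.fst ∨ ∃ S ∈ e.powersetCard (k - 1), insert v S ∉ Q) :=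
        fun h => hjb (Finset.mem_filter.2 ⟨Finset.mem_univ _, (hpb v).2 h⟩)
      push Not at hjb'
      have hve : v ∉ e := fun h => hjb'.1 (Finset.mem_image_of_mem _ h)
      refine ⟨insert v e, by rw [Finset.card_insert_of_notMem hve, hec],
        clique_insert (by omega) heq hjb'.2, ?_, ?_⟩
      · rw [Finset.coe_insert, Set.injOn_insert (by simpa using hve)]
        refine ⟨het, ?_⟩
        have := hjb'.1
        rw [← Finset.mem_coe, Finset.coe_image] at this
        exact this
      · rw [Finset.sum_insert hve, Finset.sum_range_succ, hA _ him]
        have : a v ≤ a (σ ⟨i * m, him⟩) := by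
          apply hσ
          rw [Fin.mk_le_mk]
          have := Finset.mem_range.1 hj
          omega
        linarith
  obtain ⟨e, h1, h2, -, h4⟩ := hgreedy r le_rfl
  refine ⟨e, h1, h2, ?_⟩
  have hsum : ∑ v, a v = ∑ j ∈ range r, ∑ l ∈ range m, A (j * m + l) := by
    rw [← Equiv.sum_comp σ, ← Equiv.sum_comp finProdFinEquiv, Fintype.sum_prod_type,
      ← Fin.sum_univ_eq_sum_range (fun j => ∑ l ∈ range m, A (j * m + l))]
    refine Finset.sum_congr rfl (fun j _ => ?_)
    rw [← Fin.sum_univ_eq_sum_range (fun l => A (j * m + l))]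
    refine Finset.sum_congr rfl (fun l _ => ?_)
    have hlt : (j:ℕ) * m + l < r * m := by
      have := (finProdFinEquiv (j, l)).2
      simp only [finProdFinEquiv_apply_val] at this
      nlinarith
    rw [hA _ hlt]
    congr 2
    ext
    simp only [finProdFinEquiv_apply_val]
    ring
  rw [hsum]
  calc (m:ℝ) * ∑ v ∈ e, a v ≤ m * ∑ j ∈ range r, A (j * m) := by gcongr
    _ = ∑ j ∈ range r, ∑ l ∈ range m, A (j * m) := by
        rw [Finset.mul_sum]; simp
    _ ≤ _ := by
        apply Finset.sum_le_sum
        intro j hj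
        apply Finset.sum_le_sum
        intro l hl
        rw [Finset.mem_range] at hj hl
        have h5 : j * m + l < r * m := by
          calc j * m + l < j * m + m := by omega
            _ = (j + 1) * m := by ring
            _ ≤ r * m := Nat.mul_le_mul_right _ hj
        rw [hA _ h5, hA (j * m) (by omega)]
        apply hσ
        rw [Fin.mk_le_mk]; omega

lemma frac_tiling (k r m : ℕ) (hk : 3 ≤ k) (hkr : k ≤ r) (hrm : r ≤ m)
    (Q : Finset (Finset (Fin m × Fin r)))
    (hQc : ∀ e ∈ Q, e.card = k) (hQt : ∀ e ∈ Q, Set.InjOn Prod.fst (e : Set (Fin m × Fin r)))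
    (hdeg : ∀ S : Finset (Fin m × Fin r), S.card = k - 1 →
      Set.InjOn Prod.fst (S : Set (Fin m × Fin r)) →
      (univ.filter (fun v => insert v S ∉ Q)).card *
        ((r - 1).choose (k - 1) + (r - 2).choose (k - 2)) ≤ r * m) :
    ∃ w : Finset (Fin m × Fin r) → ℝ, (∀ e, 0 ≤ w e) ∧
      (∀ e, w e ≠ 0 → e.card = r ∧ HIsClique Q k e) ∧
      (∀ v, ∑ e ∈ univ.filter (fun e => v ∈ e), w e = 1) ∧ ∑ e, w e = m := by
  let ind : Finset (Fin m × Fin r) → (Fin m × Fin r → ℝ) := fun e v => if v ∈ e then 1 else 0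
  have hind : Function.Injective ind := by
    intro e e' h
    ext v
    have := congrFun h v
    simp only [ind] at this
    by_cases h1 : v ∈ e <;> by_cases h2 : v ∈ e' <;> simp_all
  let 𝒞 : Finset (Finset (Fin m × Fin r)) := univ.filter (fun e => e.card = r ∧ HIsClique Q k e)
  have hm0 : (0:ℝ) < m := by
    have : 0 < m := by omega
    exact_mod_cast this
  let u : Fin m × Fin r → ℝ := fun _ => 1 / m
  have hu : u ∈ convexHull ℝ ((𝒞.image ind : Finset (Fin m × Fin r → ℝ)) : Set (Fin m × Fin r → ℝ)) := by
    by_contra hcon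
    obtain ⟨φ, s, h1, h2⟩ := geometric_hahn_banach_point_closed (convex_convexHull ℝ _)
      (Set.Finite.isClosed_convexHull ℝ (Finset.finite_toSet _)) hcon
    let a : Fin m × Fin r → ℝ := fun v => φ (Pi.single v 1)
    have hφ : ∀ x, φ x = ∑ v, x v * a v := by
      intro x
      have := LinearMap.pi_apply_eq_sum_univ (φ : (Fin m × Fin r → ℝ) →ₗ[ℝ] ℝ) x
      simp only [ContinuousLinearMap.coe_coe, smul_eq_mul] at this
      rw [this]
      refine Finset.sum_congr rfl (fun v _ => ?_)
      congr 2
      funext j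
      simp [Pi.single_apply, eq_comm]
    obtain ⟨e, he1, he2, he3⟩ := frac_greedy k r m hk hkr hrm Q hQc hQt hdeg a
    have h3 := h2 (ind e) (subset_convexHull ℝ _ (by
      rw [Finset.mem_coe]
      exact Finset.mem_image_of_mem _ (Finset.mem_filter.2 ⟨Finset.mem_univ _, he1, he2⟩)))
    have h4 := h1.trans h3
    rw [hφ, hφ] at h4
    have h5 : ∑ v, ind e v * a v = ∑ v ∈ e, a v := by
      simp [ind]
    have h6 : ∑ v, u v * a v = (1 / m) * ∑ v, a v := by
      rw [Finset.mul_sum]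
    rw [h5, h6, one_div, inv_mul_lt_iff₀ hm0] at h4
    linarith
  rw [Finset.mem_convexHull'] at hu
  obtain ⟨w, hw0, hw1, hw2⟩ := hu
  rw [Finset.sum_image (fun _ _ _ _ h => hind h)] at hw1 hw2
  refine ⟨fun e => if e ∈ 𝒞 then m * w (ind e) else 0, ?_, ?_, ?_, ?_⟩
  · intro e
    dsimp only
    split_ifs with h
    · exact mul_nonneg hm0.le (hw0 _ (Finset.mem_image_of_mem _ h))
    · exact le_rfl
  · intro e he
    have : e ∈ 𝒞 := by
      by_contra h
      simp [h] at he
    exact (Finset.mem_filter.1 this).2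
  · intro v
    have := congrFun hw2 v
    simp only [Finset.sum_apply, Pi.smul_apply, smul_eq_mul, u, ind] at this
    rw [Finset.sum_filter]
    have h7 : ∑ e, (if v ∈ e then (if e ∈ 𝒞 then m * w (ind e) else 0) else 0)
        = m * ∑ e ∈ 𝒞, w (ind e) * (if v ∈ e then 1 else 0) := by
      rw [Finset.mul_sum, ← Finset.sum_filter_add_sum_filter_not univ (fun e => e ∈ 𝒞)]
      rw [show univ.filter (fun e => e ∈ 𝒞) = 𝒞 by ext; simp]
      rw [Finset.sum_eq_zero (s := univ.filter (fun e => ¬ e ∈ 𝒞)), add_zero]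
      · refine Finset.sum_congr rfl (fun e he => ?_)
        simp [he]
      · intro e he
        simp [(Finset.mem_filter.1 he).2]
    rw [h7]
    simp only [ind]
    rw [this]
    field_simp
  · rw [Finset.sum_ite_mem, Finset.univ_inter, ← Finset.mul_sum, hw1, mul_one]

/-- `W` can be perfectly tiled by `r`-cliques. -/
def Til {V : Type} [DecidableEq V] (H : Finset (Finset V)) (k r : ℕ) (W : Finset V) : Prop :=
  ∃ M : Finset (Finset V), (∀ A ∈ M, ∀ B ∈ M, A ≠ B → Disjoint A B) ∧
    (∀ A ∈ M, A.card = r ∧ HIsClique H k A) ∧ M.biUnion id = W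

lemma Til.union {V : Type} [DecidableEq V] {H : Finset (Finset V)} {k r : ℕ} {W W' : Finset V}
    (h : Til H k r W) (h' : Til H k r W') (hd : Disjoint W W') : Til H k r (W ∪ W') := by
  obtain ⟨M, h1, h2, h3⟩ := h
  obtain ⟨M', h1', h2', h3'⟩ := h'
  have hMM : ∀ A ∈ M, ∀ B ∈ M', Disjoint A B := by
    intro A hA B hB
    refine Disjoint.mono ?_ ?_ hd
    · rw [← h3]; exact Finset.subset_biUnion_of_mem id hA
    · rw [← h3']; exact Finset.subset_biUnion_of_mem id hB
  refine ⟨M ∪ M', ?_, ?_, ?_⟩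
  · intro A hA B hB hAB
    rcases Finset.mem_union.1 hA with hA | hA <;> rcases Finset.mem_union.1 hB with hB | hB
    · exact h1 A hA B hB hAB
    · exact hMM A hA B hB
    · exact (hMM B hB A hA).symm
    · exact h1' A hA B hB hAB
  · intro A hA
    rcases Finset.mem_union.1 hA with hA | hA
    · exact h2 A hA
    · exact h2' A hA
  · rw [Finset.union_biUnion, h3, h3']

lemma til_empty {V : Type} [DecidableEq V] (H : Finset (Finset V)) (k r : ℕ) : Til H k r ∅ :=
  ⟨∅, by simp, by simp, by simp⟩

lemma til_single {V : Type} [DecidableEq V] {H : Finset (Finset V)} {k r : ℕ} {A : Finset V}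
    (h1 : A.card = r) (h2 : HIsClique H k A) : Til H k r A := by
  refine ⟨{A}, ?_, ?_, by simp⟩
  · intro B hB C hC hBC
    rw [Finset.mem_singleton] at hB hC
    exact absurd (hB.trans hC.symm) hBC
  · intro B hB
    rw [Finset.mem_singleton] at hB
    subst hB; exact ⟨h1, h2⟩

lemma til_biUnion {V ι : Type} [DecidableEq V] {H : Finset (Finset V)} {k r : ℕ}
    (s : Finset ι) (A : ι → Finset V) (hA : ∀ i ∈ s, Til H k r (A i))
    (hd : ∀ i ∈ s, ∀ j ∈ s, i ≠ j → Disjoint (A i) (A j)) : Til H k r (s.biUnion A) := by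
  induction s using Finset.induction_on with
  | empty => simpa using til_empty H k r
  | insert a s ha ih =>
    rw [Finset.biUnion_insert]
    refine Til.union (hA a (by simp)) (ih (fun i hi => hA i (by simp [hi]))
      (fun i hi j hj => hd i (by simp [hi]) j (by simp [hj]))) ?_
    rw [Finset.disjoint_biUnion_right]
    intro i hi
    exact hd a (by simp) i (by simp [hi]) (fun h => ha (h ▸ hi))

lemma ext_count {V : Type} [Fintype V] [DecidableEq V] (H : Finset (Finset V)) (k D z : ℕ) (μ δ : ℝ)
    (hμ : 0 ≤ μ)
    (hmiss : ∀ S : Finset V, S.card = k - 1 →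
      ((univ.filter (fun v => insert v S ∉ H)).card : ℝ) ≤ μ * Fintype.card V)
    (𝒮 : Finset (Finset V)) (h𝒮 : ∀ S ∈ 𝒮, S.card = k - 1) (h𝒮c : 𝒮.card ≤ D)
    (Z : Finset V) (hZ : Z.card ≤ z)
    (hδ : D * (μ * Fintype.card V) + z + δ ≤ Fintype.card V)
    (p : V → Prop) (hp : ∀ v, v ∉ Z → (∀ S ∈ 𝒮, insert v S ∈ H) → p v) :
    δ ≤ ((univ.filter p).card : ℝ) := by
  let B := Z ∪ 𝒮.biUnion (fun S => univ.filter (fun v => insert v S ∉ H))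
  have hB : (B.card : ℝ) ≤ z + D * (μ * Fintype.card V) := by
    have h1 : B.card ≤ Z.card + ∑ S ∈ 𝒮, (univ.filter (fun v => insert v S ∉ H)).card :=
      (Finset.card_union_le _ _).trans (Nat.add_le_add_left Finset.card_biUnion_le _)
    have h2 : (B.card : ℝ) ≤ Z.card + ∑ S ∈ 𝒮, ((univ.filter (fun v => insert v S ∉ H)).card : ℝ) := by
      exact_mod_cast h1
    have h3 : ∑ S ∈ 𝒮, ((univ.filter (fun v => insert v S ∉ H)).card : ℝ)
        ≤ D * (μ * Fintype.card V) := by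
      refine (Finset.sum_le_card_nsmul _ _ _ (fun S hS => hmiss S (h𝒮 S hS))).trans ?_
      rw [nsmul_eq_mul]
      gcongr
    have h4 : (Z.card : ℝ) ≤ z := by exact_mod_cast hZ
    linarith
  have hsub : univ \ B ⊆ univ.filter p := by
    intro v hv
    have hv' := (Finset.mem_sdiff.1 hv).2
    simp only [B, Finset.mem_union, Finset.mem_biUnion, Finset.mem_filter, Finset.mem_univ,
      true_and, not_or, not_exists, not_and, not_not] at hv'
    exact Finset.mem_filter.2 ⟨Finset.mem_univ _, hp v hv'.1 hv'.2⟩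
  have h5 : Fintype.card V ≤ (univ.filter p).card + B.card := by
    have h6 := Finset.le_card_sdiff B (univ : Finset V)
    have h7 := Finset.card_le_card hsub
    rw [Finset.card_univ] at h6
    omega
  have h5' : (Fintype.card V : ℝ) ≤ (univ.filter p).card + B.card := by exact_mod_cast h5
  linarith

lemma greedy_count {V : Type} [Fintype V] (P : ∀ i, (Fin i → V) → Prop) (δ : ℝ) (hδ : 0 ≤ δ)
    (h0 : ∀ g, P 0 g) (L : ℕ)
    (hstep : ∀ i < L, ∀ g : Fin i → V, P i g →
      δ ≤ ((univ.filter (fun v => P (i+1) (Fin.cons v g))).card : ℝ)) :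
    ∀ i ≤ L, δ ^ i ≤ ((univ.filter (fun g : Fin i → V => P i g)).card : ℝ) := by
  intro i
  induction i with
  | zero =>
    intro _
    have : (univ.filter (fun g : Fin 0 → V => P 0 g)) = univ := by
      ext g; simp [h0 g]
    rw [this]; simp
  | succ i ih =>
    intro hi
    have h1 : ((univ.filter (fun g : Fin i → V => P i g)).sigma
        (fun g => univ.filter (fun v => P (i+1) (Fin.cons v g)))).card ≤
        (univ.filter (fun g : Fin (i+1) → V => P (i+1) g)).card := by
      apply Finset.card_le_card_of_injOn (fun p => (Fin.cons p.2 p.1 : Fin (i+1) → V))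
      · rintro ⟨g, v⟩ hp
        have hp' := Finset.mem_sigma.1 (Finset.mem_coe.1 hp)
        exact Finset.mem_coe.2 (Finset.mem_filter.2 ⟨Finset.mem_univ _, (Finset.mem_filter.1 hp'.2).2⟩)
      · rintro ⟨g, v⟩ _ ⟨g', v'⟩ _ h
        obtain ⟨h1, h2⟩ := Fin.cons_injective2 h
        dsimp only at h1 h2
        subst h1; subst h2; rfl
    rw [Finset.card_sigma] at h1
    have h2 : (∑ g ∈ univ.filter (fun g : Fin i → V => P i g),
        ((univ.filter (fun v => P (i+1) (Fin.cons v g))).card : ℝ)) ≤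
        (univ.filter (fun g : Fin (i+1) → V => P (i+1) g)).card := by exact_mod_cast h1
    refine le_trans ?_ h2
    refine le_trans ?_ (Finset.card_nsmul_le_sum _ _ δ (fun g hg => hstep i (by omega) g (Finset.mem_filter.1 hg).2))
    rw [nsmul_eq_mul, pow_succ]
    exact mul_le_mul_of_nonneg_right (ih (by omega)) hδ

lemma image_cons {V : Type} [DecidableEq V] {i : ℕ} (v : V) (g : Fin i → V) :
    univ.image (Fin.cons v g : Fin (i+1) → V) = insert v (univ.image g) := by
  ext u
  simp only [Finset.mem_image, Finset.mem_univ, true_and, Finset.mem_insert, Fin.exists_fin_succ,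
    Fin.cons_zero, Fin.cons_succ]
  rw [eq_comm]

lemma inj_cons {V : Type} [DecidableEq V] {i : ℕ} (v : V) (g : Fin i → V)
    (hv : v ∉ univ.image g) (hg : Function.Injective g) :
    Function.Injective (Fin.cons v g : Fin (i+1) → V) := by
  rw [Fin.cons_injective_iff]
  refine ⟨?_, hg⟩
  rintro ⟨j, hj⟩
  exact hv (Finset.mem_image.2 ⟨j, Finset.mem_univ _, hj⟩)

/-- `g` links `x` and `y`. -/
def Link {V : Type} [DecidableEq V] (H : Finset (Finset V)) (k : ℕ) (x y : V) (i : ℕ)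
    (g : Fin i → V) : Prop :=
  Function.Injective g ∧ x ∉ univ.image g ∧ y ∉ univ.image g ∧
    HIsClique H k (insert x (univ.image g)) ∧ HIsClique H k (insert y (univ.image g))

lemma pair_count {V : Type} [Fintype V] [DecidableEq V] (H : Finset (Finset V)) (k r : ℕ) (μ δ : ℝ)
    (hk : 3 ≤ k) (hkr : k ≤ r) (hμ : 0 ≤ μ) (hδ0 : 0 ≤ δ)
    (hmiss : ∀ S : Finset V, S.card = k - 1 →
      ((univ.filter (fun v => insert v S ∉ H)).card : ℝ) ≤ μ * Fintype.card V)
    (hδ : (((r - 1).choose (k - 1) + (r - 2).choose (k - 2) : ℕ) : ℝ) * (μ * Fintype.card V)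
      + (r + 2 : ℕ) + δ ≤ Fintype.card V) (x y : V) :
    δ ^ (r - 1) ≤ ((univ.filter (fun g : Fin (r - 1) → V => Link H k x y (r - 1) g)).card : ℝ) := by
  refine greedy_count (Link H k x y) δ hδ0 ?_ (r - 1) ?_ (r - 1) le_rfl
  · intro g
    refine ⟨Function.injective_of_subsingleton _, by simp, by simp, ?_, ?_⟩ <;>
    · apply clique_small
      simp; omega
  · intro i hi g ⟨g1, g2, g3, g4, g5⟩
    set I := univ.image g with hI
    have hIc : I.card = i := by rw [hI, Finset.card_image_of_injective _ g1]; simp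
    let 𝒮 := (insert x I).powersetCard (k - 1) ∪ (insert y I).powersetCard (k - 1)
    refine ext_count H k _ (r + 2) μ δ hμ hmiss 𝒮 ?_ ?_ (insert x (insert y I)) ?_ hδ _ ?_
    · intro S hS
      rcases Finset.mem_union.1 hS with h | h <;> exact (Finset.mem_powersetCard.1 h).2
    · have h1 := Finset.card_union_add_card_inter ((insert x I).powersetCard (k - 1))
        ((insert y I).powersetCard (k - 1))
      have h2 : I.powersetCard (k - 1) ⊆ (insert x I).powersetCard (k - 1) ∩ (insert y I).powersetCard (k - 1) := by
        apply Finset.subset_inter <;> exact Finset.powersetCard_mono (Finset.subset_insert _ _)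
      have h3 := Finset.card_le_card h2
      rw [Finset.card_powersetCard, Finset.card_powersetCard, Finset.card_insert_of_notMem g2,
        Finset.card_insert_of_notMem g3, hIc] at h1
      rw [Finset.card_powersetCard, hIc] at h3
      obtain ⟨k', rfl⟩ : ∃ k', k = k' + 2 := ⟨k - 2, by omega⟩
      obtain ⟨r', rfl⟩ : ∃ r', r = r' + 2 := ⟨r - 2, by omega⟩
      simp only [show k' + 2 - 1 = k' + 1 by omega, show r' + 2 - 1 = r' + 1 by omega,
        Nat.add_sub_cancel] at *
      have h4 := Nat.choose_succ_succ i k'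
      have h5 := Nat.choose_succ_succ r' k'
      have h6 : i.choose k' ≤ r'.choose k' := Nat.choose_le_choose _ (by omega)
      have h7 : i.choose (k'+1) ≤ r'.choose (k'+1) := Nat.choose_le_choose _ (by omega)
      simp only [Nat.succ_eq_add_one] at h4 h5
      change ((insert x I).powersetCard (k' + 1) ∪ (insert y I).powersetCard (k' + 1)).card ≤ _
      omega
    · have := Finset.card_insert_le x (insert y I)
      have := Finset.card_insert_le y I
      omega
    · intro v hvZ hvS
      simp only [Finset.mem_insert, not_or] at hvZ
      obtain ⟨hvx, hvy, hvI⟩ := hvZ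
      refine ⟨inj_cons v g hvI g1, ?_, ?_, ?_, ?_⟩
      · rw [image_cons, Finset.mem_insert, not_or]; exact ⟨fun h => hvx h.symm, g2⟩
      · rw [image_cons, Finset.mem_insert, not_or]; exact ⟨fun h => hvy h.symm, g3⟩
      · rw [image_cons, Finset.insert_comm]
        exact clique_insert (by omega) g4 (fun S hS => hvS S (Finset.mem_union_left _ hS))
      · rw [image_cons, Finset.insert_comm]
        exact clique_insert (by omega) g5 (fun S hS => hvS S (Finset.mem_union_right _ hS))

/-- `g` is an injective tuple spanning a clique. -/
def CliqueTup {V : Type} [DecidableEq V] (H : Finset (Finset V)) (k : ℕ) (i : ℕ)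
    (g : Fin i → V) : Prop :=
  Function.Injective g ∧ HIsClique H k (univ.image g)

lemma clique_count {V : Type} [Fintype V] [DecidableEq V] (H : Finset (Finset V)) (k r : ℕ) (μ δ : ℝ)
    (hk : 3 ≤ k) (hkr : k ≤ r) (hμ : 0 ≤ μ) (hδ0 : 0 ≤ δ)
    (hmiss : ∀ S : Finset V, S.card = k - 1 →
      ((univ.filter (fun v => insert v S ∉ H)).card : ℝ) ≤ μ * Fintype.card V)
    (hδ : (((r - 1).choose (k - 1) + (r - 2).choose (k - 2) : ℕ) : ℝ) * (μ * Fintype.card V)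
      + (r + 2 : ℕ) + δ ≤ Fintype.card V) :
    δ ^ r ≤ ((univ.filter (fun g : Fin r → V => CliqueTup H k r g)).card : ℝ) := by
  refine greedy_count (CliqueTup H k)
    δ hδ0 ?_ r ?_ r le_rfl
  · intro g
    exact ⟨Function.injective_of_subsingleton _, clique_small (by simp; omega)⟩
  · intro i hi g ⟨g1, g2⟩
    set I := univ.image g with hI
    have hIc : I.card = i := by rw [hI, Finset.card_image_of_injective _ g1]; simp
    refine ext_count H k _ (r + 2) μ δ hμ hmiss (I.powersetCard (k - 1)) ?_ ?_ I (by omega) hδ _ ?_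
    · intro S hS
      exact (Finset.mem_powersetCard.1 hS).2
    · rw [Finset.card_powersetCard, hIc]
      have : i.choose (k - 1) ≤ (r - 1).choose (k - 1) := Nat.choose_le_choose _ (by omega)
      omega
    · intro v hvI hvS
      refine ⟨inj_cons v g hvI g1, ?_⟩
      rw [image_cons]
      exact clique_insert (by omega) g2 hvS

/-- The tuple `g` absorbs the set `R`. -/
def Absb {V ι : Type} [DecidableEq V] [Fintype ι] (H : Finset (Finset V)) (k r : ℕ) (R : Finset V)
    (g : ι → V) : Prop :=
  Function.Injective g ∧ (∀ p, g p ∉ R) ∧ Til H k r (univ.image g) ∧ Til H k r (univ.image g ∪ R)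

/-- raw absorbing structure -/
def RawAbs {V : Type} [DecidableEq V] (H : Finset (Finset V)) (k r : ℕ) (x : Fin r → V)
    (g : Fin r × Option (Fin (r - 1)) → V) : Prop :=
  CliqueTup H k r (fun i => g (i, none)) ∧
    ∀ i, Link H k (x i) (g (i, none)) (r - 1) (fun j => g (i, some j))

lemma raw_absb {V : Type} [DecidableEq V] (H : Finset (Finset V)) (k r : ℕ) (hr : 1 ≤ r)
    (x : Fin r → V) (hx : Function.Injective x)
    (g : Fin r × Option (Fin (r - 1)) → V) (hg : RawAbs H k r x g) (hinj : Function.Injective g)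
    (hhit : ∀ p, g p ∉ univ.image x) : Absb H k r (univ.image x) g := by
  obtain ⟨⟨hy, hyc⟩, hl⟩ := hg
  refine ⟨hinj, hhit, ?_, ?_⟩
  · have h1 : univ.image g = univ.biUnion (fun i => insert (g (i, none))
        (univ.image (fun j => g (i, some j)))) := by
      ext u
      simp only [Finset.mem_image, Finset.mem_univ, true_and, Prod.exists, Option.exists,
        Finset.mem_biUnion, Finset.mem_insert, eq_comm]
    rw [h1]
    apply til_biUnion
    · intro i _
      obtain ⟨l1, l2, l3, l4, l5⟩ := hl i
      apply til_single _ l5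
      rw [Finset.card_insert_of_notMem l3, Finset.card_image_of_injective _ l1]
      simp; omega
    · intro i _ j _ hij
      rw [Finset.disjoint_left]
      intro u hu hu'
      simp only [Finset.mem_image, Finset.mem_univ, true_and, Finset.mem_insert] at hu hu'
      rcases hu with rfl | ⟨a, rfl⟩ <;> rcases hu' with h | ⟨b, h⟩ <;>
        · have := congrArg Prod.fst (hinj h)
          simp only at this
          first | exact hij this | exact hij this.symm
  · have h1 : univ.image g ∪ univ.image x = univ.image (fun i => g (i, none)) ∪
        univ.biUnion (fun i => insert (x i) (univ.image (fun j => g (i, some j)))) := by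
      ext u
      simp only [Finset.mem_image, Finset.mem_univ, true_and, Prod.exists, Option.exists,
        Finset.mem_biUnion, Finset.mem_insert, Finset.mem_union, exists_or, eq_comm]
      constructor
      · rintro ((h | h) | h)
        · exact Or.inl h
        · exact Or.inr (Or.inr h)
        · exact Or.inr (Or.inl h)
      · rintro (h | h | h)
        · exact Or.inl (Or.inl h)
        · exact Or.inr h
        · exact Or.inl (Or.inr h)
    rw [h1]
    apply Til.union
    · apply til_single _ hyc
      rw [Finset.card_image_of_injective _ hy]; simp
    · apply til_biUnion
      · intro i _
        obtain ⟨l1, l2, l3, l4, l5⟩ := hl i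
        apply til_single _ l4
        rw [Finset.card_insert_of_notMem l2, Finset.card_image_of_injective _ l1]
        simp; omega
      · intro i _ j _ hij
        rw [Finset.disjoint_left]
        intro u hu hu'
        simp only [Finset.mem_image, Finset.mem_univ, true_and, Finset.mem_insert] at hu hu'
        rcases hu with rfl | ⟨a, rfl⟩ <;> rcases hu' with h | ⟨b, h⟩
        · exact hij (hx h)
        · exact hhit (j, some b) (by rw [h]; simp)
        · exact hhit (i, some a) (by rw [h]; simp)
        · have := congrArg Prod.fst (hinj h)
          exact hij this.symm
    · rw [Finset.disjoint_left]
      intro u hu hu'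
      simp only [Finset.mem_image, Finset.mem_univ, true_and, Finset.mem_insert,
        Finset.mem_biUnion] at hu hu'
      obtain ⟨a, rfl⟩ := hu
      obtain ⟨i, h | ⟨b, h⟩⟩ := hu'
      · exact hhit (a, none) (by rw [h]; simp)
      · have := congrArg Prod.snd (hinj h)
        simp at this

lemma raw_count {V : Type} [Fintype V] [DecidableEq V] (H : Finset (Finset V)) (k r : ℕ) (μ δ : ℝ)
    (hk : 3 ≤ k) (hkr : k ≤ r) (hμ : 0 ≤ μ) (hδ0 : 0 ≤ δ)
    (hmiss : ∀ S : Finset V, S.card = k - 1 →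
      ((univ.filter (fun v => insert v S ∉ H)).card : ℝ) ≤ μ * Fintype.card V)
    (hδ : (((r - 1).choose (k - 1) + (r - 2).choose (k - 2) : ℕ) : ℝ) * (μ * Fintype.card V)
      + (r + 2 : ℕ) + δ ≤ Fintype.card V) (x : Fin r → V) :
    δ ^ (r * r) ≤ ((univ.filter (fun g : Fin r × Option (Fin (r - 1)) → V =>
      RawAbs H k r x g)).card : ℝ) := by
  have hc := clique_count H k r μ δ hk hkr hμ hδ0 hmiss hδ
  have hp := fun a b => pair_count H k r μ δ hk hkr hμ hδ0 hmiss hδ a b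
  let LS : (Fin r → V) → Finset (Fin r → (Fin (r-1) → V)) := fun y =>
    Fintype.piFinset (fun i => univ.filter (fun g => Link H k (x i) (y i) (r-1) g))
  have h1 : ((univ.filter (fun y : Fin r → V => CliqueTup H k r y)).sigma LS).card ≤
      (univ.filter (fun g : Fin r × Option (Fin (r - 1)) → V => RawAbs H k r x g)).card := by
    apply Finset.card_le_card_of_injOn
      (fun p => (fun q : Fin r × Option (Fin (r - 1)) => q.2.elim (p.1 q.1) (p.2 q.1)))
    · rintro ⟨y, S⟩ h
      have h' := Finset.mem_sigma.1 (Finset.mem_coe.1 h)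
      refine Finset.mem_coe.2 (Finset.mem_filter.2 ⟨Finset.mem_univ _, ?_, ?_⟩)
      · exact (Finset.mem_filter.1 h'.1).2
      · intro i
        exact (Finset.mem_filter.1 (Fintype.mem_piFinset.1 h'.2 i)).2
    · rintro ⟨y, S⟩ _ ⟨y', S'⟩ _ h
      have e1 : y = y' := by
        funext i; exact congrFun h (i, none)
      have e2 : S = S' := by
        funext i j; exact congrFun h (i, some j)
      subst e1; subst e2; rfl
  rw [Finset.card_sigma] at h1
  have h2 : (∑ y ∈ univ.filter (fun y : Fin r → V => CliqueTup H k r y), ((LS y).card : ℝ)) ≤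
      (univ.filter (fun g : Fin r × Option (Fin (r - 1)) → V => RawAbs H k r x g)).card := by
    exact_mod_cast h1
  refine le_trans ?_ h2
  have h3 : ∀ y, (δ ^ (r-1)) ^ r ≤ ((LS y).card : ℝ) := by
    intro y
    have : ((LS y).card : ℝ) = ∏ i : Fin r, ((univ.filter (fun g => Link H k (x i) (y i) (r-1) g)).card : ℝ) := by
      simp only [LS, Fintype.card_piFinset]; push_cast; rfl
    rw [this]
    have := Finset.prod_le_prod (s := (univ : Finset (Fin r))) (f := fun _ => δ ^ (r-1))
      (g := fun i => ((univ.filter (fun g => Link H k (x i) (y i) (r-1) g)).card : ℝ))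
      (fun i _ => pow_nonneg hδ0 _) (fun i _ => hp (x i) (y i))
    simpa using this
  refine le_trans ?_ (Finset.card_nsmul_le_sum _ _ _ (fun y _ => h3 y))
  rw [nsmul_eq_mul]
  have e : r * r = r + (r - 1) * r := by
    obtain ⟨r', rfl⟩ : ∃ r', r = r' + 1 := ⟨r - 1, by omega⟩
    simp; ring
  rw [e, pow_add, pow_mul]
  exact mul_le_mul_of_nonneg_right hc (by positivity)

lemma clean_count {V ι : Type} [Fintype V] [DecidableEq V] [Fintype ι] [DecidableEq ι] (L r : ℕ)
    (hL : Fintype.card ι = L) (P Q : (ι → V) → Prop) (R : Finset V) (hR : R.card = r)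
    (hPQ : ∀ g, P g → Function.Injective g → (∀ p, g p ∉ R) → Q g) :
    ((univ.filter P).card : ℝ) * Fintype.card V ≤ ((univ.filter Q).card : ℝ) * Fintype.card V
      + ((L : ℝ)^2 + L * r) * (Fintype.card V : ℝ) ^ L := by
  have h2 := card_noninj (ι := ι) (V := V)
  have h3 := card_hit (ι := ι) (V := V) R
  rw [hL] at h2 h3
  rw [hR] at h3
  have h4 : univ.filter P ⊆ univ.filter Q ∪
      (univ.filter (fun g => ¬ Function.Injective g) ∪ univ.filter (fun g => ∃ p, g p ∈ R)) := by
    intro g hg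
    have hg := (Finset.mem_filter.1 hg).2
    by_cases hi : Function.Injective g
    · by_cases hh : ∃ p, g p ∈ R
      · exact Finset.mem_union_right _ (Finset.mem_union_right _ (Finset.mem_filter.2 ⟨Finset.mem_univ _, hh⟩))
      · apply Finset.mem_union_left
        refine Finset.mem_filter.2 ⟨Finset.mem_univ _, ?_⟩
        exact hPQ g hg hi (fun p hp => hh ⟨p, hp⟩)
    · exact Finset.mem_union_right _ (Finset.mem_union_left _ (Finset.mem_filter.2 ⟨Finset.mem_univ _, hi⟩))
  have h5 := (Finset.card_le_card h4).trans ((Finset.card_union_le _ _).trans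
    (Nat.add_le_add_left (Finset.card_union_le _ _) _))
  have h6 := Nat.mul_le_mul_right (Fintype.card V) h5
  rw [add_mul, add_mul] at h6
  have h7 := h6.trans (Nat.add_le_add_left (Nat.add_le_add (by convert h2) (by convert h3)) _)
  have h9 : (((univ.filter P).card * Fintype.card V : ℕ) : ℝ) ≤ _ :=
    Nat.cast_le.2 h7
  push_cast at h9
  linarith

lemma absorber_count {V : Type} [Fintype V] [DecidableEq V] (H : Finset (Finset V)) (k r : ℕ) (μ δ : ℝ)
    (hk : 3 ≤ k) (hkr : k ≤ r) (hμ : 0 ≤ μ) (hδ0 : 0 ≤ δ)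
    (hmiss : ∀ S : Finset V, S.card = k - 1 →
      ((univ.filter (fun v => insert v S ∉ H)).card : ℝ) ≤ μ * Fintype.card V)
    (hδ : (((r - 1).choose (k - 1) + (r - 2).choose (k - 2) : ℕ) : ℝ) * (μ * Fintype.card V)
      + (r + 2 : ℕ) + δ ≤ Fintype.card V) (R : Finset V) (hR : R.card = r) :
    δ ^ (r * r) * Fintype.card V ≤ ((univ.filter (fun g : Fin r × Option (Fin (r - 1)) → V =>
      Absb H k r R g)).card : ℝ) * Fintype.card V + ((r * r)^2 + r * r * r) * (Fintype.card V : ℝ) ^ (r * r) := by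
  obtain ⟨x, hxi, hxR⟩ : ∃ x : Fin r → V, Function.Injective x ∧ univ.image x = R := by
    refine ⟨fun i => ((R.equivFinOfCardEq hR).symm i : V), ?_, ?_⟩
    · exact Subtype.val_injective.comp (Equiv.injective _)
    · ext u
      simp only [Finset.mem_image, Finset.mem_univ, true_and]
      constructor
      · rintro ⟨i, rfl⟩; exact Subtype.mem _
      · intro hu; exact ⟨R.equivFinOfCardEq hR ⟨u, hu⟩, by simp⟩
  subst hxR
  have hcι : Fintype.card (Fin r × Option (Fin (r - 1))) = r * r := by
    simp; left; omega
  have h1 := raw_count H k r μ δ hk hkr hμ hδ0 hmiss hδ x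
  have h2 := clean_count (ι := Fin r × Option (Fin (r - 1))) (r * r) r hcι
    (RawAbs H k r x) (Absb H k r (univ.image x)) (univ.image x) hR
    (fun g hg hi hh => raw_absb H k r (by omega) x hxi g hg hi hh)
  have h8 := mul_le_mul_of_nonneg_right h1 (Nat.cast_nonneg (α := ℝ) (Fintype.card V))
  refine h8.trans (h2.trans (le_of_eq ?_))
  push_cast
  rfl

lemma absorb_ind {V ι : Type} [DecidableEq V] [Fintype ι] (H : Finset (Finset V))
    (k r : ℕ) : ∀ (s : ℕ) (F : Finset (ι → V)) (W : Finset V),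
    (∀ g ∈ F, ∀ g' ∈ F, g ≠ g' → Disjoint (univ.image g) (univ.image g')) →
    (∀ g ∈ F, Til H k r (univ.image g)) →
    (∀ g ∈ F, Disjoint (univ.image g) W) → W.card = r * s →
    (∀ X ⊆ W, X.card = r → s ≤ (F.filter (fun g => Absb H k r X g)).card) →
    Til H k r (F.biUnion (fun g => univ.image g) ∪ W) := by
  intro s
  induction s with
  | zero =>
    intro F W h1 h2 h3 h4 _
    have : W = ∅ := Finset.card_eq_zero.1 (by simpa using h4)
    rw [this, Finset.union_empty]
    exact til_biUnion F _ h2 h1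
  | succ s ih =>
    intro F W h1 h2 h3 h4 h5
    obtain ⟨X, hXW, hXc⟩ := Finset.exists_subset_card_eq (s := W) (n := r) (by rw [h4]; nlinarith)
    have h6 := h5 X hXW hXc
    obtain ⟨g, hg⟩ := Finset.card_pos.1 (lt_of_lt_of_le (Nat.succ_pos s) h6)
    obtain ⟨hgF, hgA⟩ := Finset.mem_filter.1 hg
    have h7 := ih (F.erase g) (W \ X) (fun a ha b hb => h1 a (Finset.mem_of_mem_erase ha) b (Finset.mem_of_mem_erase hb))
      (fun a ha => h2 a (Finset.mem_of_mem_erase ha))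
      (fun a ha => Disjoint.mono_right Finset.sdiff_subset (h3 a (Finset.mem_of_mem_erase ha)))
      (by rw [Finset.card_sdiff_of_subset hXW, h4, hXc, Nat.mul_succ, Nat.add_sub_cancel])
      (by
        intro Y hY hYc
        have h8 := h5 Y (hY.trans Finset.sdiff_subset) hYc
        have h9 : (F.filter (fun g => Absb H k r Y g)) ⊆
            insert g ((F.erase g).filter (fun g => Absb H k r Y g)) := by
          intro a ha
          obtain ⟨ha1, ha2⟩ := Finset.mem_filter.1 ha
          by_cases hag : a = g
          · subst hag; exact Finset.mem_insert_self _ _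
          · exact Finset.mem_insert_of_mem (Finset.mem_filter.2 ⟨Finset.mem_erase.2 ⟨hag, ha1⟩, ha2⟩)
        have h10 := (Finset.card_le_card h9).trans (Finset.card_insert_le _ _)
        omega)
    have h8 := Til.union h7 hgA.2.2.2 (by
      rw [Finset.disjoint_union_left, Finset.disjoint_union_right, Finset.disjoint_union_right]
      refine ⟨⟨?_, ?_⟩, ?_, ?_⟩
      · rw [Finset.disjoint_biUnion_left]
        intro a ha
        exact h1 a (Finset.mem_of_mem_erase ha) g hgF (Finset.ne_of_mem_erase ha)
      · rw [Finset.disjoint_biUnion_left]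
        intro a ha
        exact Disjoint.mono_right hXW (h3 a (Finset.mem_of_mem_erase ha))
      · exact (Disjoint.mono_right Finset.sdiff_subset (h3 g hgF)).symm
      · exact Finset.sdiff_disjoint)
    have e : F.biUnion (fun g => univ.image g) ∪ W =
        ((F.erase g).biUnion (fun g => univ.image g) ∪ (W \ X)) ∪ (univ.image g ∪ X) := by
      conv_lhs => rw [← Finset.insert_erase hgF, Finset.biUnion_insert, ← Finset.sdiff_union_of_subset hXW]
      ext u; simp only [Finset.mem_union]; tauto
    rw [e]; exact h8

/-- the pattern of a sampled tuple -/
noncomputable def Pat {T V : Type} [DecidableEq V] (H : Finset (Finset V)) (k r m : ℕ)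
    (vert : T × Fin r → V) (f : Fin m → T) : Finset (Finset (Fin m × Fin r)) :=
  univ.filter (fun e => e.card = k ∧ Set.InjOn Prod.fst (e : Set (Fin m × Fin r)) ∧
    e.image (fun p => vert (f p.1, p.2)) ∈ H)

lemma mem_pat {T V : Type} [DecidableEq V] (H : Finset (Finset V)) (k r m : ℕ)
    (vert : T × Fin r → V) (f : Fin m → T) (e : Finset (Fin m × Fin r)) :
    e ∈ Pat H k r m vert f ↔ e.card = k ∧ Set.InjOn Prod.fst (e : Set (Fin m × Fin r)) ∧
    e.image (fun p => vert (f p.1, p.2)) ∈ H := by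
  unfold Pat; rw [Finset.mem_filter]; simp

/-- failure at `S` -/
def BadAt {T V : Type} [DecidableEq V] (H : Finset (Finset V)) (k r m D : ℕ)
    (vert : T × Fin r → V) (S : Finset (Fin m × Fin r)) (f : Fin m → T) : Prop :=
  r * m < (univ.filter (fun v => insert v S ∉ Pat H k r m vert f)).card * D

lemma bad_sum {T V : Type} [DecidableEq V] (H : Finset (Finset V)) (k r m D : ℕ)
    (hk : 1 ≤ k) (hr : 1 ≤ r) (hD : 0 < D)
    (vert : T × Fin r → V) (S : Finset (Fin m × Fin r)) (f : Fin m → T)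
    (hS : S.card = k - 1) (hSi : Set.InjOn Prod.fst (S : Set (Fin m × Fin r)))
    (S' : Finset V) (hS' : S.image (fun p => vert (f p.1, p.2)) = S')
    (hbad : BadAt H k r m D vert S f) :
    (m : ℝ) / D - (k - 1 : ℕ) ≤ ∑ i : {i : Fin m // ¬ i ∈ S.image Prod.fst},
      ((univ.filter (fun a : Fin r => insert (vert (f i, a)) S' ∉ H)).card : ℝ) / r := by
  let I := S.image Prod.fst
  have hI : I.card = k - 1 := by rw [← hS]; exact Finset.card_image_of_injOn hSi
  have hsub : univ.filter (fun v => insert v S ∉ Pat H k r m vert f) ⊆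
      (I ×ˢ (univ : Finset (Fin r))) ∪
      (univ : Finset {i : Fin m // ¬ i ∈ I}).biUnion (fun i =>
        (univ.filter (fun a : Fin r => insert (vert (f i, a)) S' ∉ H)).image (fun a => ((i : Fin m), a))) := by
    rintro ⟨i, a⟩ hv
    have hv := (Finset.mem_filter.1 hv).2
    by_cases hi : i ∈ I
    · exact Finset.mem_union_left _ (Finset.mem_product.2 ⟨hi, Finset.mem_univ _⟩)
    · apply Finset.mem_union_right
      refine Finset.mem_biUnion.2 ⟨⟨i, hi⟩, Finset.mem_univ _, Finset.mem_image.2 ⟨a, ?_, rfl⟩⟩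
      refine Finset.mem_filter.2 ⟨Finset.mem_univ _, fun hH => hv ?_⟩
      have hnS : (i, a) ∉ S := fun h => hi (Finset.mem_image.2 ⟨_, h, rfl⟩)
      rw [mem_pat]
      refine ⟨?_, ?_, ?_⟩
      · rw [Finset.card_insert_of_notMem hnS, hS]; omega
      · rw [Finset.coe_insert, Set.injOn_insert (by exact_mod_cast hnS)]
        refine ⟨hSi, ?_⟩
        rintro ⟨q, hq, hq'⟩
        exact hi (Finset.mem_image.2 ⟨q, hq, hq'⟩)
      · rw [Finset.image_insert, hS']; exact hH
  have h1 := (Finset.card_le_card hsub).trans ((Finset.card_union_le _ _).trans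
    (Nat.add_le_add_left (Finset.card_biUnion_le.trans
      (Finset.sum_le_sum (fun i _ => Finset.card_image_le))) _))
  rw [Finset.card_product, hI, Finset.card_univ, Fintype.card_fin] at h1
  have h2 : ((univ.filter (fun v => insert v S ∉ Pat H k r m vert f)).card : ℝ) ≤
      ((k - 1 : ℕ) : ℝ) * r + ∑ i : {i : Fin m // ¬ i ∈ I},
        ((univ.filter (fun a : Fin r => insert (vert (f i, a)) S' ∉ H)).card : ℝ) := by
    exact_mod_cast h1
  have h3 : (r : ℝ) * m < ((univ.filter (fun v => insert v S ∉ Pat H k r m vert f)).card : ℝ) * D := by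
    unfold BadAt at hbad
    exact_mod_cast hbad
  have hr' : (0 : ℝ) < r := by exact_mod_cast hr
  have hD' : (0 : ℝ) < D := by exact_mod_cast hD
  rw [← Finset.sum_div, le_div_iff₀ hr', sub_mul, sub_le_iff_le_add', div_mul_eq_mul_div, div_le_iff₀ hD']
  have := mul_le_mul_of_nonneg_right h2 hD'.le
  linarith [mul_comm (r:ℝ) m]

lemma bad_count {T V : Type} [Fintype T] [Fintype V] [DecidableEq V] (H : Finset (Finset V))
    (k r m D : ℕ) (b c ρ : ℝ) (hc0 : 0 ≤ c) (hρ : 0 ≤ ρ)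
    (hch : ∀ (ι T : Type) [Fintype ι] [DecidableEq ι] [Fintype T] (Z : T → ℝ), (∀ τ, 0 ≤ Z τ) →
      (∀ τ, Z τ ≤ 1) → ∑ τ, Z τ ≤ b * Fintype.card T →
      ((univ.filter (fun f : ι → T => c * Fintype.card ι ≤ ∑ i, Z (f i))).card : ℝ)
        ≤ ρ ^ Fintype.card ι * (Fintype.card T : ℝ) ^ Fintype.card ι)
    (hk : 1 ≤ k) (hr : 1 ≤ r) (hD : 0 < D)
    (vert : T × Fin r → V) (hvert : Function.Injective vert)
    (hmiss : ∀ S : Finset V, S.card = k - 1 →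
      ((univ.filter (fun v => insert v S ∉ H)).card : ℝ) ≤ b * (r * Fintype.card T))
    (hcm : c * m + (k - 1 : ℕ) ≤ (m : ℝ) / D)
    (S : Finset (Fin m × Fin r))
    (hS : S.card = k - 1) (hSi : Set.InjOn Prod.fst (S : Set (Fin m × Fin r))) :
    ((univ.filter (fun f : Fin m → T => Function.Injective f ∧ BadAt H k r m D vert S f)).card : ℝ)
      ≤ ρ ^ (m - (k - 1)) * (Fintype.card T : ℝ) ^ m := by
  let I := S.image Prod.fst
  have hI : I.card = k - 1 := by rw [← hS]; exact Finset.card_image_of_injOn hSi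
  have hIm : k - 1 ≤ m := by
    rw [← hI]; simpa using Finset.card_le_univ I
  have hcI : Fintype.card {i : Fin m // i ∈ I} = k - 1 := by rw [Fintype.card_coe, hI]
  have hcI' : Fintype.card {i : Fin m // ¬ i ∈ I} = m - (k - 1) := by
    rw [Fintype.card_subtype_compl, hcI, Fintype.card_fin]
  let Bd := univ.filter (fun f : Fin m → T => Function.Injective f ∧ BadAt H k r m D vert S f)
  let res : (Fin m → T) → ({i : Fin m // i ∈ I} → T) := fun f i => f i
  have hr' : (0 : ℝ) < r := by exact_mod_cast hr
  have hfib : ∀ h : {i : Fin m // i ∈ I} → T, ((Bd.filter (fun f => res f = h)).card : ℝ) ≤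
      ρ ^ (m - (k - 1)) * (Fintype.card T : ℝ) ^ (m - (k - 1)) := by
    intro h
    rcases (Bd.filter (fun f => res f = h)).eq_empty_or_nonempty with he | ⟨f0, hf0⟩
    · rw [he]; simp only [Finset.card_empty, Nat.cast_zero]; positivity
    obtain ⟨hf0B, hf0h⟩ := Finset.mem_filter.1 hf0
    obtain ⟨hf0i, hf0b⟩ := (Finset.mem_filter.1 hf0B).2
    let S' := S.image (fun p => vert (f0 p.1, p.2))
    have hS'c : S'.card = k - 1 := by
      rw [← hS]
      apply Finset.card_image_of_injOn
      intro p hp q hq hpq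
      have h1 := hvert hpq
      have h2 := hf0i (congrArg Prod.fst h1)
      exact Prod.ext h2 (Prod.mk.inj h1).2
    let Z : T → ℝ := fun τ => ((univ.filter (fun a : Fin r => insert (vert (τ, a)) S' ∉ H)).card : ℝ) / r
    have hZ0 : ∀ τ, 0 ≤ Z τ := fun τ => by positivity
    have hZ1 : ∀ τ, Z τ ≤ 1 := fun τ => by
      rw [div_le_one hr']
      have := Finset.card_le_univ (univ.filter (fun a : Fin r => insert (vert (τ, a)) S' ∉ H))
      rw [Fintype.card_fin] at this
      exact_mod_cast this
    have hZs : ∑ τ, Z τ ≤ b * Fintype.card T := by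
      have h1 : ∑ τ, (univ.filter (fun a : Fin r => insert (vert (τ, a)) S' ∉ H)).card ≤
          (univ.filter (fun v => insert v S' ∉ H)).card := by
        rw [← Finset.card_sigma]
        apply Finset.card_le_card_of_injOn (fun p => vert (p.1, p.2))
        · rintro ⟨τ, a⟩ hp
          have hp' := Finset.mem_sigma.1 (Finset.mem_coe.1 hp)
          exact Finset.mem_coe.2 (Finset.mem_filter.2 ⟨Finset.mem_univ _, (Finset.mem_filter.1 hp'.2).2⟩)
        · rintro ⟨τ, a⟩ _ ⟨τ', a'⟩ _ hh
          have h1 := hvert hh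
          rw [Prod.mk.injEq] at h1
          obtain ⟨h1, h2⟩ := h1
          dsimp only at h1 h2
          subst h1; subst h2; rfl
      have h2 : ∑ τ, ((univ.filter (fun a : Fin r => insert (vert (τ, a)) S' ∉ H)).card : ℝ) ≤
          (univ.filter (fun v => insert v S' ∉ H)).card := by exact_mod_cast h1
      have h3 := hmiss S' hS'c
      simp only [Z]
      rw [← Finset.sum_div, div_le_iff₀ hr']
      linarith
    have hC := hch {i : Fin m // ¬ i ∈ I} T Z hZ0 hZ1 hZs
    rw [hcI'] at hC
    refine le_trans ?_ hC
    rw [Nat.cast_le]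
    apply Finset.card_le_card_of_injOn (fun f => (fun i : {i : Fin m // ¬ i ∈ I} => f i))
    · intro f hf
      obtain ⟨hfB, hfh⟩ := Finset.mem_filter.1 (Finset.mem_coe.1 hf)
      obtain ⟨hfi, hfb⟩ := (Finset.mem_filter.1 hfB).2
      refine Finset.mem_coe.2 (Finset.mem_filter.2 ⟨Finset.mem_univ _, ?_⟩)
      have hSf : S.image (fun p => vert (f p.1, p.2)) = S' := by
        apply Finset.image_congr
        intro p hp
        have h1 := congrFun (hfh.trans hf0h.symm) ⟨p.1, Finset.mem_image.2 ⟨p, hp, rfl⟩⟩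
        simp only [res] at h1
        simp only [h1]
      have h2 := bad_sum H k r m D hk hr hD vert S f hS hSi S' hSf hfb
      have h3 : c * ((m - (k - 1) : ℕ) : ℝ) ≤ c * m := by
        apply mul_le_mul_of_nonneg_left _ hc0
        exact_mod_cast Nat.sub_le _ _
      have h4 : c * ((m - (k - 1) : ℕ) : ℝ) ≤ (m : ℝ) / D - (k - 1 : ℕ) := by linarith
      exact h4.trans h2
    · intro f hf f' hf' hff
      obtain ⟨_, hfh⟩ := Finset.mem_filter.1 (Finset.mem_coe.1 hf)
      obtain ⟨_, hfh'⟩ := Finset.mem_filter.1 (Finset.mem_coe.1 hf')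
      funext i
      by_cases hi : i ∈ I
      · exact congrFun (hfh.trans hfh'.symm) ⟨i, hi⟩
      · exact congrFun hff ⟨i, hi⟩
  have h1 := Finset.card_eq_sum_card_fiberwise (f := res) (s := Bd) (t := univ) (fun _ _ => by simp)
  have h2 : (Bd.card : ℝ) = ∑ h, ((Bd.filter (fun f => res f = h)).card : ℝ) := by exact_mod_cast h1
  change (Bd.card : ℝ) ≤ _
  rw [h2]
  refine (Finset.sum_le_card_nsmul _ _ _ (fun h _ => hfib h)).trans (le_of_eq ?_)
  rw [Finset.card_univ, Fintype.card_fun, hcI, nsmul_eq_mul]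
  push_cast
  have : m = (k - 1) + (m - (k - 1)) := by omega
  conv_rhs => rw [this, pow_add (Fintype.card T : ℝ)]
  have e : k - 1 + (m - (k - 1)) - (k - 1) = m - (k - 1) := by omega
  rw [e]; ring

lemma card_eval_mem {ι T : Type} [Fintype ι] [DecidableEq ι] [Fintype T] (i : ι) (U : Finset T) :
    U.card * Fintype.card T ^ Fintype.card ι ≤
      (univ.filter (fun g : ι → T => g i ∈ U)).card * Fintype.card T := by
  rw [← Fintype.card_fun, ← Finset.card_univ (α := ι → T), ← Finset.card_product,
    ← Finset.card_univ (α := T), ← Finset.card_product]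
  apply Finset.card_le_card_of_injOn (fun p => (Function.update p.2 i p.1, p.2 i))
  · rintro ⟨u, g⟩ h
    have h := (Finset.mem_product.1 (Finset.mem_coe.1 h)).1
    refine Finset.mem_coe.2 (Finset.mem_product.2 ⟨Finset.mem_filter.2 ⟨Finset.mem_univ _, ?_⟩, Finset.mem_univ _⟩)
    simpa using h
  · rintro ⟨u, g⟩ _ ⟨u', g'⟩ _ h
    obtain ⟨h1, h2⟩ := Prod.mk.inj h
    dsimp only at h1 h2
    have e1 : u = u' := by simpa using congrFun h1 i
    have e2 : g = g' := by
      funext j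
      by_cases hj : j = i
      · subst hj; exact h2
      · simpa [hj] using congrFun h1 j
    rw [e1, e2]

/-- good sampled tuples -/
def GoodTup {T V : Type} [DecidableEq V] (H : Finset (Finset V)) (k r m D : ℕ)
    (vert : T × Fin r → V) (Dum : Finset T) (i0 : Fin m) (f : Fin m → T) : Prop :=
  Function.Injective f ∧ f i0 ∈ Dum ∧ ∀ S : Finset (Fin m × Fin r), S.card = k - 1 →
    Set.InjOn Prod.fst (S : Set (Fin m × Fin r)) → ¬ BadAt H k r m D vert S f

lemma good_count {T V : Type} [Fintype T] [DecidableEq V] (H : Finset (Finset V))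
    (k r m D : ℕ) (γ σ : ℝ) (hσ : 0 ≤ σ)
    (vert : T × Fin r → V) (Dum : Finset T) (i0 : Fin m) (hDum : γ * Fintype.card T ≤ Dum.card)
    (hbad : ∀ S : Finset (Fin m × Fin r), S.card = k - 1 →
      Set.InjOn Prod.fst (S : Set (Fin m × Fin r)) →
      ((univ.filter (fun f : Fin m → T => Function.Injective f ∧ BadAt H k r m D vert S f)).card : ℝ)
        ≤ σ * (Fintype.card T : ℝ) ^ m)
    (hσ2 : ((r * m : ℕ) : ℝ) ^ (k - 1) * σ ≤ γ / 4) (ht : 0 < Fintype.card T)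
    (ht2 : (m : ℝ) ^ 2 ≤ γ / 4 * Fintype.card T) :
    γ / 2 * (Fintype.card T : ℝ) ^ m ≤
      ((univ.filter (fun f : Fin m → T => GoodTup H k r m D vert Dum i0 f)).card : ℝ) := by
  let 𝒮 : Finset (Finset (Fin m × Fin r)) := (univ.powersetCard (k - 1)).filter
    (fun S => Set.InjOn Prod.fst (S : Set (Fin m × Fin r)))
  have h𝒮 : (𝒮.card : ℝ) ≤ ((r * m : ℕ) : ℝ) ^ (k - 1) := by
    have h1 : 𝒮.card ≤ (r * m) ^ (k - 1) := by
      refine (Finset.card_filter_le _ _).trans ?_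
      rw [Finset.card_powersetCard, Finset.card_univ, Fintype.card_prod, Fintype.card_fin, Fintype.card_fin,
        mul_comm m r]
      exact Nat.choose_le_pow _ _
    exact_mod_cast h1
  have ht' : (0 : ℝ) < Fintype.card T := by exact_mod_cast ht
  have hsub : univ.filter (fun f : Fin m → T => f i0 ∈ Dum) ⊆
      univ.filter (fun f : Fin m → T => GoodTup H k r m D vert Dum i0 f) ∪
      (univ.filter (fun f : Fin m → T => ¬ Function.Injective f) ∪
      𝒮.biUnion (fun S => univ.filter (fun f : Fin m → T => Function.Injective f ∧ BadAt H k r m D vert S f))) := by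
    intro f hf
    have hf := (Finset.mem_filter.1 hf).2
    by_cases hi : Function.Injective f
    · by_cases hg : GoodTup H k r m D vert Dum i0 f
      · exact Finset.mem_union_left _ (Finset.mem_filter.2 ⟨Finset.mem_univ _, hg⟩)
      · apply Finset.mem_union_right
        apply Finset.mem_union_right
        have : ∃ S : Finset (Fin m × Fin r), S.card = k - 1 ∧
            Set.InjOn Prod.fst (S : Set (Fin m × Fin r)) ∧ BadAt H k r m D vert S f := by
          by_contra hcon
          push Not at hcon
          exact hg ⟨hi, hf, hcon⟩
        obtain ⟨S, hS1, hS2, hS3⟩ := this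
        refine Finset.mem_biUnion.2 ⟨S, Finset.mem_filter.2 ⟨Finset.mem_powersetCard.2 ⟨Finset.subset_univ _, hS1⟩, hS2⟩, ?_⟩
        exact Finset.mem_filter.2 ⟨Finset.mem_univ _, hi, hS3⟩
    · exact Finset.mem_union_right _ (Finset.mem_union_left _ (Finset.mem_filter.2 ⟨Finset.mem_univ _, hi⟩))
  have h1 := (Finset.card_le_card hsub).trans ((Finset.card_union_le _ _).trans
    (Nat.add_le_add_left ((Finset.card_union_le _ _).trans (Nat.add_le_add_left Finset.card_biUnion_le _)) _))
  have h2 : ((univ.filter (fun f : Fin m → T => f i0 ∈ Dum)).card : ℝ) ≤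
      (univ.filter (fun f : Fin m → T => GoodTup H k r m D vert Dum i0 f)).card +
      ((univ.filter (fun f : Fin m → T => ¬ Function.Injective f)).card +
      ∑ S ∈ 𝒮, ((univ.filter (fun f : Fin m → T => Function.Injective f ∧ BadAt H k r m D vert S f)).card : ℝ)) := by
    exact_mod_cast h1
  have h3 : ∑ S ∈ 𝒮, ((univ.filter (fun f : Fin m → T => Function.Injective f ∧ BadAt H k r m D vert S f)).card : ℝ)
      ≤ γ / 4 * (Fintype.card T : ℝ) ^ m := by
    refine (Finset.sum_le_card_nsmul _ _ (σ * (Fintype.card T : ℝ) ^ m) ?_).trans ?_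
    · intro S hS
      obtain ⟨hS1, hS2⟩ := Finset.mem_filter.1 hS
      exact hbad S (Finset.mem_powersetCard.1 hS1).2 hS2
    · rw [nsmul_eq_mul, ← mul_assoc]
      apply mul_le_mul_of_nonneg_right _ (by positivity)
      exact (mul_le_mul_of_nonneg_right h𝒮 hσ).trans hσ2
  have h4 := card_noninj (ι := Fin m) (V := T)
  rw [Fintype.card_fin] at h4
  have h4' : ((univ.filter (fun f : Fin m → T => ¬ Function.Injective f)).card : ℝ) ≤
      γ / 4 * (Fintype.card T : ℝ) ^ m := by
    have h5 : ((univ.filter (fun f : Fin m → T => ¬ Function.Injective f)).card : ℝ) * Fintype.card T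
        ≤ (m : ℝ) ^ 2 * (Fintype.card T : ℝ) ^ m := by exact_mod_cast h4
    have h6 : (m : ℝ) ^ 2 * (Fintype.card T : ℝ) ^ m ≤ (γ / 4 * (Fintype.card T : ℝ) ^ m) * Fintype.card T := by
      have := mul_le_mul_of_nonneg_right ht2 (by positivity : (0:ℝ) ≤ (Fintype.card T : ℝ) ^ m)
      linarith
    exact le_of_mul_le_mul_right (h5.trans h6) ht'
  have h7 := card_eval_mem i0 Dum
  rw [Fintype.card_fin] at h7
  have h7' : γ * (Fintype.card T : ℝ) ^ m ≤ ((univ.filter (fun f : Fin m → T => f i0 ∈ Dum)).card : ℝ) := by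
    have h8 : (Dum.card : ℝ) * (Fintype.card T : ℝ) ^ m ≤
        ((univ.filter (fun f : Fin m → T => f i0 ∈ Dum)).card : ℝ) * Fintype.card T := by exact_mod_cast h7
    have h9 := mul_le_mul_of_nonneg_right hDum (by positivity : (0:ℝ) ≤ (Fintype.card T : ℝ) ^ m)
    refine le_of_mul_le_mul_right ?_ ht'
    linarith
  linarith

lemma exists_m (k r : ℕ) (ρ γ c d : ℝ) (hρ : 0 < ρ) (hρ1 : ρ < 1) (hγ : 0 < γ) (hcd : c < d) :
    ∃ m : ℕ, r ≤ m ∧ ((r * m : ℕ) : ℝ) ^ (k - 1) * ρ ^ (m - (k - 1)) ≤ γ / 4 ∧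
      c * m + (k - 1 : ℕ) ≤ (m : ℝ) * d := by
  have h1 := tendsto_pow_const_mul_const_pow_of_abs_lt_one (k - 1) (r := ρ) (by rw [abs_of_pos hρ]; exact hρ1)
  have h2 := h1.const_mul ((r : ℝ) ^ (k - 1) * (ρ ^ (k - 1))⁻¹)
  rw [mul_zero] at h2
  have h3 := h2.eventually (gt_mem_nhds (show (0:ℝ) < γ / 4 by positivity))
  obtain ⟨m, hm, hmr, hmk, hmc⟩ := (h3.and ((Filter.eventually_ge_atTop r).and
    ((Filter.eventually_ge_atTop (k - 1)).and (Filter.eventually_ge_atTop ⌈((k - 1 : ℕ) : ℝ) / (d - c)⌉₊)))).exists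
  refine ⟨m, hmr, ?_, ?_⟩
  · refine le_trans (le_of_eq ?_) hm.le
    push_cast
    rw [mul_pow, pow_sub₀ _ hρ.ne' hmk]
    ring
  · have := (Nat.le_ceil _).trans (Nat.cast_le (α := ℝ).2 hmc)
    rw [div_le_iff₀ (by linarith)] at this
    linarith

lemma good_box (k r D : ℕ) (hk : 3 ≤ k) (hkr : k ≤ r) (hD : 0 < D) (b γ : ℝ) (hb : 0 ≤ b)
    (hbD : b < 1 / D) (hγ : 0 < γ) :
    ∃ m : ℕ, r ≤ m ∧ ∃ i0 : Fin m, ∀ N : ℕ, 1 ≤ N → ∃ t₀ : ℕ, ∀ (T V : Type) [Fintype T] [Fintype V]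
      [DecidableEq V] (H : Finset (Finset V)) (vert : T × Fin r → V), Function.Injective vert →
      (∀ S : Finset V, S.card = k - 1 →
        ((univ.filter (fun v => insert v S ∉ H)).card : ℝ) ≤ b * (r * Fintype.card T)) →
      t₀ ≤ Fintype.card T → ∀ Dum : Finset T, γ * Fintype.card T ≤ Dum.card →
      ∃ (B : Fin m → Finset T) (Q : Finset (Finset (Fin m × Fin r))), (∀ i, (B i).card = N) ∧
        ∀ f, (∀ i, f i ∈ B i) → GoodTup H k r m D vert Dum i0 f ∧ Pat H k r m vert f = Q := by
  obtain ⟨c, hbc, hcD⟩ := exists_between hbD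
  obtain ⟨ρ, hρ, hρ1, hch⟩ := chernoff_count b c hb hbc
  obtain ⟨m, hrm, hm1, hm2⟩ := exists_m k r ρ γ c (1 / D) hρ hρ1 hγ hcD
  refine ⟨m, hrm, ⟨0, by omega⟩, fun N hN => ?_⟩
  let K : ℕ := Fintype.card (Finset (Finset (Fin m × Fin r)))
  have hK : 0 < K := Fintype.card_pos
  have hK' : (0 : ℝ) < K := by exact_mod_cast hK
  obtain ⟨t₁, ht₁⟩ := box_theorem N hN m (γ / 2 / K) (by positivity)
  refine ⟨t₁ + ⌈(m:ℝ)^2 / (γ / 4)⌉₊ + 1, ?_⟩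
  intro T V _ _ _ H vert hvert hmiss ht Dum hDum
  have h1 : γ / 2 * (Fintype.card T : ℝ) ^ m ≤
      ((univ.filter (fun f : Fin m → T => GoodTup H k r m D vert Dum ⟨0, by omega⟩ f)).card : ℝ) := by
    apply good_count H k r m D γ (ρ ^ (m - (k - 1))) (by positivity) vert Dum _ hDum _ hm1 (by omega)
    · have h2 : ⌈(m:ℝ)^2 / (γ / 4)⌉₊ ≤ Fintype.card T := by omega
      have h3 := (Nat.le_ceil _).trans (Nat.cast_le (α := ℝ).2 h2)
      rw [div_le_iff₀ (by positivity)] at h3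
      linarith
    · intro S hS hSi
      exact bad_count H k r m D b c ρ (by linarith) hρ.le hch (by omega) (by omega) hD vert hvert hmiss
        (by rw [div_eq_mul_one_div]; exact hm2) S hS hSi
  obtain ⟨Q, _, hQ⟩ := Finset.exists_le_card_fiber_of_nsmul_le_card_of_maps_to
    (s := univ.filter (fun f : Fin m → T => GoodTup H k r m D vert Dum ⟨0, by omega⟩ f))
    (t := (univ : Finset (Finset (Finset (Fin m × Fin r))))) (f := fun f => Pat H k r m vert f)
    (b := γ / 2 / K * (Fintype.card T : ℝ) ^ m) (fun _ _ => Finset.mem_univ _) Finset.univ_nonempty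
    (by
      refine le_trans (le_of_eq ?_) h1
      rw [Finset.card_univ, nsmul_eq_mul]
      change (K : ℝ) * _ = _
      field_simp)
  obtain ⟨B, hB1, hB2⟩ := ht₁ T (by omega) _ hQ
  refine ⟨B, Q, hB1, fun f hf => ?_⟩
  obtain ⟨h2, h3⟩ := Finset.mem_filter.1 (hB2 f hf)
  exact ⟨(Finset.mem_filter.1 h2).2, h3⟩

lemma exists_injOn_of_card_le {α β : Type} (X : Finset α) (B : Finset β) (h : X.card ≤ B.card)
    (hB : B.Nonempty) : ∃ φ : α → β, (∀ x ∈ X, φ x ∈ B) ∧ Set.InjOn φ (X : Set α) := by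
  have h1 : Fintype.card {x // x ∈ X} ≤ Fintype.card {x // x ∈ B} := by
    rw [Fintype.card_coe, Fintype.card_coe]; exact h
  obtain ⟨ψ⟩ := Function.Embedding.nonempty_of_card_le h1
  obtain ⟨b, hb⟩ := hB
  refine ⟨fun x => if hx : x ∈ X then (ψ ⟨x, hx⟩ : β) else b, ?_, ?_⟩
  · intro x hx
    simp only [hx, dif_pos]; exact Subtype.mem _
  · intro x hx y hy hxy
    have hx' : x ∈ X := hx
    have hy' : y ∈ X := hy
    simp only [hx', hy', dif_pos] at hxy
    have := ψ.injective (Subtype.ext hxy)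
    exact congrArg Subtype.val this

lemma blowup {T V : Type} [DecidableEq V] (H : Finset (Finset V)) (k r m N : ℕ)
    (hk : 3 ≤ k) (hkr : k ≤ r) (hrm : r ≤ m) (hN : 2 ^ (m * r) < N)
    (vert : T × Fin r → V) (hvert : Function.Injective vert) (Dum : Finset T) (i0 : Fin m)
    (B : Fin m → Finset T) (Q : Finset (Finset (Fin m × Fin r))) (hB : ∀ i, (B i).card = N)
    (hBQ : ∀ f, (∀ i, f i ∈ B i) →
      GoodTup H k r m ((r-1).choose (k-1) + (r-2).choose (k-2)) vert Dum i0 f ∧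
      Pat H k r m vert f = Q) :
    ∃ K : Finset (Finset V), (∀ A ∈ K, ∀ A' ∈ K, A ≠ A' → Disjoint A A') ∧
      (∀ A ∈ K, A.card = r ∧ HIsClique H k A) ∧ N * m < K.card + N ∧
      (∀ A ∈ K, ∀ u ∈ A, ∃ i, ∃ τ ∈ B i, ∃ a, u = vert (τ, a)) := by
  have hBne : ∀ i, (B i).Nonempty := fun i => Finset.card_pos.1 (by rw [hB]; exact lt_of_le_of_lt (Nat.zero_le _) hN)
  choose f0 hf0 using hBne
  have hBd : ∀ i j, ∀ τ, τ ∈ B i → τ ∈ B j → i = j := by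
    intro i j τ hi hj
    by_contra hij
    have h1 := (hBQ (Function.update (Function.update f0 i τ) j τ) (by
      intro l
      by_cases hl : l = j
      · subst hl; simpa using hj
      · rw [Function.update_of_ne hl]
        by_cases hl' : l = i
        · subst hl'; simpa using hi
        · rw [Function.update_of_ne hl']; exact hf0 l)).1.1
    apply hij
    apply h1
    rw [Function.update_of_ne hij]; simp
  obtain ⟨⟨hg1, hg2, hg3⟩, hPQ⟩ := hBQ f0 hf0
  have hQc : ∀ e ∈ Q, e.card = k := by
    intro e he; rw [← hPQ, mem_pat] at he; exact he.1
  have hQt : ∀ e ∈ Q, Set.InjOn Prod.fst (e : Set (Fin m × Fin r)) := by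
    intro e he; rw [← hPQ, mem_pat] at he; exact he.2.1
  obtain ⟨w, w0, w1, w2, w3⟩ := frac_tiling k r m hk hkr hrm Q hQc hQt (by
    intro S hS hSi
    have := hg3 S hS hSi
    unfold BadAt at this
    rw [hPQ] at this
    exact not_lt.1 this)
  let c : Finset (Fin m × Fin r) → ℕ := fun e => ⌊(N : ℝ) * w e⌋₊
  let X : Finset (Σ _ : Finset (Fin m × Fin r), ℕ) := univ.sigma (fun e => range (c e))
  have hcle : ∀ e, (c e : ℝ) ≤ N * w e := fun e => Nat.floor_le (by have := w0 e; positivity)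
  have hXv : ∀ v, (X.filter (fun p => v ∈ p.1)).card ≤ (B v.1).card := by
    intro v
    have h1 : X.filter (fun p => v ∈ p.1) ⊆ (univ.filter (fun e => v ∈ e)).sigma (fun e => range (c e)) := by
      rintro ⟨e, l⟩ hp
      obtain ⟨hp1, hp2⟩ := Finset.mem_filter.1 hp
      exact Finset.mem_sigma.2 ⟨Finset.mem_filter.2 ⟨Finset.mem_univ _, hp2⟩, (Finset.mem_sigma.1 hp1).2⟩
    have h2 := Finset.card_le_card h1
    rw [Finset.card_sigma] at h2
    simp only [Finset.card_range] at h2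
    refine h2.trans ?_
    rw [hB]
    have h3 : (∑ e ∈ univ.filter (fun e => v ∈ e), (c e : ℝ)) ≤ N := by
      refine (Finset.sum_le_sum (fun e _ => hcle e)).trans ?_
      rw [← Finset.mul_sum, w2 v, mul_one]
    exact_mod_cast h3
  choose φ hφ1 hφ2 using fun v => exists_injOn_of_card_le _ _ (hXv v) ⟨f0 v.1, hf0 v.1⟩
  have hXe : ∀ p ∈ X, p.1.card = r ∧ HIsClique Q k p.1 := by
    rintro ⟨e, l⟩ hp
    apply w1
    intro h0
    have h1 := Finset.mem_range.1 (Finset.mem_sigma.1 hp).2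
    simp [c, h0] at h1
  have hXi : ∀ p ∈ X, Set.InjOn Prod.fst (p.1 : Set (Fin m × Fin r)) := by
    intro p hp v hv v' hv' hvv
    obtain ⟨hc, hcl⟩ := hXe p hp
    have hsub : ({v, v'} : Finset (Fin m × Fin r)) ⊆ p.1 := by
      intro u hu
      rcases Finset.mem_insert.1 hu with rfl | hu
      · exact hv
      · rw [Finset.mem_singleton.1 hu]; exact hv'
    obtain ⟨e', h1, h2, h3⟩ := Finset.exists_subsuperset_card_eq hsub
      (n := k) ((Finset.card_insert_le _ _).trans (by simp; omega)) (by omega)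
    exact hQt e' (hcl e' h2 h3) (h1 (by simp)) (h1 (by simp)) hvv
  let C : (Σ _ : Finset (Fin m × Fin r), ℕ) → Finset V := fun p =>
    p.1.image (fun v => vert (φ v p, v.2))
  have hφB : ∀ p ∈ X, ∀ v ∈ p.1, φ v p ∈ B v.1 := fun p hp v hv =>
    hφ1 v p (Finset.mem_filter.2 ⟨hp, hv⟩)
  -- transversals
  have hf : ∀ p ∈ X, ∃ f : Fin m → T, (∀ i, f i ∈ B i) ∧ ∀ v ∈ p.1, f v.1 = φ v p := by
    intro p hp
    have hex : ∀ i, ∃ τ, τ ∈ B i ∧ ∀ v ∈ p.1, v.1 = i → τ = φ v p := by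
      intro i
      by_cases h : ∃ v ∈ p.1, v.1 = i
      · obtain ⟨v, hv, rfl⟩ := h
        refine ⟨φ v p, hφB p hp v hv, ?_⟩
        intro v' hv' hvv
        rw [hXi p hp hv' hv hvv]
      · exact ⟨f0 i, hf0 i, fun v hv hvi => absurd ⟨v, hv, hvi⟩ h⟩
    choose f hf1 hf2 using hex
    exact ⟨f, hf1, fun v hv => hf2 v.1 v hv rfl⟩
  have hCl : ∀ p ∈ X, (C p).card = r ∧ HIsClique H k (C p) := by
    intro p hp
    obtain ⟨f, hfB, hfφ⟩ := hf p hp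
    obtain ⟨⟨hfi, _, _⟩, hfQ⟩ := hBQ f hfB
    have hinj : Function.Injective (fun v : Fin m × Fin r => vert (f v.1, v.2)) := by
      intro u v huv
      have h1 := Prod.mk.inj (hvert huv)
      exact Prod.ext (hfi h1.1) h1.2
    have hCp : C p = p.1.image (fun v => vert (f v.1, v.2)) := by
      apply Finset.image_congr
      intro v hv
      simp only [hfφ v hv]
    rw [hCp]
    obtain ⟨hc, hcl⟩ := hXe p hp
    refine ⟨by rw [Finset.card_image_of_injective _ hinj, hc], ?_⟩
    intro e' he' hek
    obtain ⟨e'', he'', rfl⟩ := Finset.subset_image_iff.1 he'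
    rw [Finset.card_image_of_injective _ hinj] at hek
    have h1 := hcl e'' (by exact_mod_cast he'') hek
    rw [← hfQ, mem_pat] at h1
    exact h1.2.2
  have hCd : ∀ p ∈ X, ∀ q ∈ X, p ≠ q → Disjoint (C p) (C q) := by
    intro p hp q hq hpq
    rw [Finset.disjoint_left]
    intro u hu hu'
    obtain ⟨v, hv, rfl⟩ := Finset.mem_image.1 hu
    obtain ⟨v', hv', h⟩ := Finset.mem_image.1 hu'
    have h1 := Prod.mk.inj (hvert h)
    have h2 : v'.1 = v.1 := hBd _ _ (φ v' q) (hφB q hq v' hv') (by rw [h1.1]; exact hφB p hp v hv)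
    have h3 : v' = v := Prod.ext h2 h1.2
    subst h3
    exact hpq (hφ2 v' (Finset.mem_coe.2 (Finset.mem_filter.2 ⟨hp, hv⟩))
      (Finset.mem_coe.2 (Finset.mem_filter.2 ⟨hq, hv'⟩)) h1.1.symm)
  have hCi : Set.InjOn C (X : Set _) := by
    intro p hp q hq hpq
    by_contra hne
    have h1 := hCd p hp q hq hne
    rw [hpq, Finset.disjoint_self_iff_empty] at h1
    have := (hCl q hq).1
    rw [h1] at this
    simp at this; omega
  refine ⟨X.image C, ?_, ?_, ?_, ?_⟩
  · intro A hA A' hA' hne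
    obtain ⟨p, hp, rfl⟩ := Finset.mem_image.1 hA
    obtain ⟨q, hq, rfl⟩ := Finset.mem_image.1 hA'
    exact hCd p hp q hq (fun h => hne (by rw [h]))
  · intro A hA
    obtain ⟨p, hp, rfl⟩ := Finset.mem_image.1 hA
    exact hCl p hp
  · rw [Finset.card_image_of_injOn hCi]
    have h1 : X.card = ∑ e, c e := by
      rw [Finset.card_sigma]; simp
    have h2 : (N : ℝ) * m - 2 ^ (m * r) ≤ ∑ e, (c e : ℝ) := by
      have h3 : ∑ e : Finset (Fin m × Fin r), ((N : ℝ) * w e - 1) ≤ ∑ e, (c e : ℝ) :=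
        Finset.sum_le_sum (fun e _ => (Nat.sub_one_lt_floor _).le)
      rw [Finset.sum_sub_distrib, ← Finset.mul_sum, w3] at h3
      simpa using h3
    have h4 : ((2 ^ (m * r) : ℕ) : ℝ) < N := by exact_mod_cast hN
    have h5 : ((N * m : ℕ) : ℝ) < ((X.card + N : ℕ) : ℝ) := by
      rw [h1]; push_cast at h4 ⊢; linarith
    exact_mod_cast h5
  · intro A hA u hu
    obtain ⟨p, hp, rfl⟩ := Finset.mem_image.1 hA
    obtain ⟨v, hv, rfl⟩ := Finset.mem_image.1 hu
    exact ⟨v.1, φ v p, hφB p hp v hv, v.2, rfl⟩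

/-- `M` is a family of disjoint `r`-cliques inside `W`. -/
def Pack {V : Type} [DecidableEq V] (H : Finset (Finset V)) (k r : ℕ) (W : Finset V)
    (M : Finset (Finset V)) : Prop :=
  (∀ A ∈ M, ∀ B ∈ M, A ≠ B → Disjoint A B) ∧ (∀ A ∈ M, A.card = r ∧ HIsClique H k A) ∧ M.biUnion id ⊆ W

lemma pack_card {V : Type} [DecidableEq V] {H : Finset (Finset V)} {k r : ℕ} {W : Finset V}
    {M : Finset (Finset V)} (h : Pack H k r W M) : (M.biUnion id).card = M.card * r := by
  rw [Finset.card_biUnion (t := id) (fun A hA B hB hne => h.1 A hA B hB hne)]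
  exact (Finset.sum_const_nat (fun A hA => (h.2.1 A hA).1))

lemma pack_frame {V : Type} [DecidableEq V] {H : Finset (Finset V)} {k r : ℕ} {W : Finset V}
    {M : Finset (Finset V)} (h : Pack H k r W M) (d : ℕ) (hd : W.card = r * (M.card + d)) :
    ∃ vert : ({A // A ∈ M} ⊕ Fin d) × Fin r → V, Function.Injective vert ∧
      (∀ A a, vert (Sum.inl A, a) ∈ A.1) ∧ (∀ A : {A // A ∈ M}, ∀ u ∈ A.1, ∃ a, vert (Sum.inl A, a) = u) ∧
      ∀ p, vert p ∈ W := by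
  have hL : (W \ M.biUnion id).card = d * r := by
    rw [Finset.card_sdiff_of_subset h.2.2, pack_card h, hd, Nat.mul_add, mul_comm r M.card,
      Nat.add_sub_cancel_left, mul_comm]
  have e1 : ∀ A : {A // A ∈ M}, Nonempty ({u // u ∈ A.1} ≃ Fin r) := fun A =>
    ⟨A.1.equivFinOfCardEq (h.2.1 A.1 A.2).1⟩
  let ε := fun A => (e1 A).some
  let η : {u // u ∈ W \ M.biUnion id} ≃ Fin d × Fin r :=
    ((W \ M.biUnion id).equivFinOfCardEq hL).trans finProdFinEquiv.symm
  let vert : ({A // A ∈ M} ⊕ Fin d) × Fin r → V := fun p =>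
    Sum.elim (fun A => (((ε A).symm p.2 : _) : V)) (fun j => ((η.symm (j, p.2) : _) : V)) p.1
  have hv1 : ∀ A a, vert (Sum.inl A, a) ∈ A.1 := fun A a => ((ε A).symm a).2
  have hv2 : ∀ j a, vert (Sum.inr j, a) ∈ W \ M.biUnion id := fun j a => (η.symm (j, a)).2
  have hmem : ∀ (A : {A // A ∈ M}) u, u ∈ A.1 → u ∈ M.biUnion id := fun A u hu =>
    Finset.mem_biUnion.2 ⟨A.1, A.2, hu⟩
  refine ⟨vert, ?_, hv1, ?_, ?_⟩
  · rintro ⟨A | j, a⟩ ⟨A' | j', a'⟩ hp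
    · have hAA : A = A' := by
        by_contra hne
        have h1 := h.1 A.1 A.2 A'.1 A'.2 (fun h => hne (Subtype.ext h))
        exact Finset.disjoint_left.1 h1 (hv1 A a) (by rw [hp]; exact hv1 A' a')
      subst hAA
      have h2 : (ε A).symm a = (ε A).symm a' := Subtype.ext hp
      rw [(ε A).symm.injective h2]
    · exact absurd (hmem A _ (hv1 A a)) (by rw [hp]; exact (Finset.mem_sdiff.1 (hv2 j' a')).2)
    · exact absurd (hmem A' _ (hv1 A' a')) (by rw [← hp]; exact (Finset.mem_sdiff.1 (hv2 j a)).2)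
    · have h2 : η.symm (j, a) = η.symm (j', a') := Subtype.ext hp
      obtain ⟨h3, h4⟩ := Prod.mk.inj (η.symm.injective h2)
      rw [h3, h4]
  · intro A u hu
    refine ⟨ε A ⟨u, hu⟩, ?_⟩
    simp [vert]
  · rintro ⟨A | j, a⟩
    · exact h.2.2 (hmem A _ (hv1 A a))
    · exact (Finset.mem_sdiff.1 (hv2 j a)).1

lemma almost (k r D : ℕ) (hk : 3 ≤ k) (hkr : k ≤ r)
    (hD : D = (r-1).choose (k-1) + (r-2).choose (k-2)) (b γ : ℝ) (hb : 0 ≤ b)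
    (hbD : b < 1 / D) (hγ : 0 < γ) :
    ∃ t₀ : ℕ, ∀ (V : Type) [Fintype V] [DecidableEq V] (H : Finset (Finset V)) (W : Finset V) (t : ℕ),
      W.card = r * t → t₀ ≤ t →
      (∀ S : Finset V, S.card = k - 1 →
        ((univ.filter (fun v => insert v S ∉ H)).card : ℝ) ≤ b * (r * t)) →
      ∃ M : Finset (Finset V), Pack H k r W M ∧ M.card ≤ t ∧ ((t - M.card : ℕ) : ℝ) ≤ γ * t := by
  have hD0 : 0 < D := by
    rw [hD]
    have := Nat.choose_pos (n := r - 1) (k := k - 1) (by omega)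
    omega
  obtain ⟨m, hrm, i0, hbox⟩ := good_box k r D hk hkr hD0 b γ hb hbD hγ
  obtain ⟨t₀, ht₀⟩ := hbox (2 ^ (m * r) + 1) (Nat.le_add_left _ _)
  refine ⟨t₀, ?_⟩
  intro V _ _ H W t hW ht hmiss
  obtain ⟨M, hM, hMmax⟩ := Finset.exists_max_image
    ((univ : Finset (Finset (Finset V))).filter (fun M => Pack H k r W M)) Finset.card
    ⟨∅, Finset.mem_filter.2 ⟨Finset.mem_univ _, by simp [Pack]⟩⟩
  have hP : Pack H k r W M := (Finset.mem_filter.1 hM).2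
  have hMt : M.card ≤ t := by
    have h1 := Finset.card_le_card hP.2.2
    rw [pack_card hP, hW, mul_comm] at h1
    exact Nat.le_of_mul_le_mul_left h1 (by omega)
  refine ⟨M, hP, hMt, ?_⟩
  by_contra hcon
  push Not at hcon
  set d := t - M.card with hd
  have htd : M.card + d = t := by omega
  obtain ⟨vert, hvi, hvA, hvA', hvW⟩ := pack_frame hP d (by rw [htd, hW])
  have hcT : Fintype.card ({A // A ∈ M} ⊕ Fin d) = t := by
    rw [Fintype.card_sum, Fintype.card_coe, Fintype.card_fin, htd]
  let Dum : Finset ({A // A ∈ M} ⊕ Fin d) := univ.map Function.Embedding.inr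
  have hDc : Dum.card = d := by simp [Dum]
  obtain ⟨B, Q, hB, hBQ⟩ := ht₀ ({A // A ∈ M} ⊕ Fin d) V H vert hvi
    (by rw [hcT]; exact hmiss) (by rw [hcT]; exact ht) Dum (by rw [hcT, hDc]; exact hcon.le)
  set N := 2 ^ (m * r) + 1 with hN
  have hN1 : 1 ≤ N := Nat.le_add_left _ _
  subst hD
  obtain ⟨K, K1, K2, K3, K4⟩ := blowup H k r m N hk hkr hrm (by omega) vert hvi Dum i0 B Q hB hBQ
  -- B i0 ⊆ Dum
  have hB0 : ∀ τ ∈ B i0, τ ∈ Dum := by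
    intro τ hτ
    have hne : ∀ i, (B i).Nonempty := fun i => Finset.card_pos.1 (by rw [hB]; omega)
    choose f0 hf0 using hne
    have h1 := (hBQ (Function.update f0 i0 τ) (by
      intro l
      by_cases hl : l = i0
      · subst hl; simpa using hτ
      · rw [Function.update_of_ne hl]; exact hf0 l)).1.2.1
    simpa using h1
  let U : Finset ({A // A ∈ M} ⊕ Fin d) := (univ.erase i0).biUnion B
  have hU : U.card ≤ (m - 1) * N := by
    refine (Finset.card_biUnion_le_card_mul _ _ N (fun i _ => (hB i).le)).trans ?_
    rw [Finset.card_erase_of_mem (Finset.mem_univ _), Finset.card_univ, Fintype.card_fin]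
  obtain ⟨p, hp⟩ : ∃ p : Finset V → Prop, ∀ A, p A ↔ ∃ h : A ∈ M, Sum.inl ⟨A, h⟩ ∈ U :=
    ⟨_, fun _ => Iff.rfl⟩
  have hrem : (M.filter p).card ≤ U.card := by
    have h1 : (M.filter p).card ≤ (U.image (fun τ => Sum.elim (fun A => A.1) (fun _ => (∅ : Finset V)) τ)).card := by
      apply Finset.card_le_card
      intro A hA
      obtain ⟨h, hU⟩ := (hp A).1 (Finset.mem_filter.1 hA).2
      exact Finset.mem_image.2 ⟨_, hU, rfl⟩
    exact h1.trans Finset.card_image_le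
  let M' := M.filter (fun A => ¬ p A)
  have hMM : (M.filter p).card + M'.card = M.card := Finset.card_filter_add_card_filter_not _
  have hKM : ∀ A ∈ M', ∀ C ∈ K, Disjoint A C := by
    intro A hA C hC
    obtain ⟨hAM, hAp⟩ := Finset.mem_filter.1 hA
    rw [Finset.disjoint_left]
    intro u huA huC
    obtain ⟨i, τ, hτ, a, rfl⟩ := K4 C hC u huC
    obtain ⟨a', ha'⟩ := hvA' ⟨A, hAM⟩ _ huA
    have h1 := (Prod.mk.inj (hvi ha')).1
    apply hAp
    rw [hp]
    refine ⟨hAM, ?_⟩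
    rw [h1]
    refine Finset.mem_biUnion.2 ⟨i, Finset.mem_erase.2 ⟨?_, Finset.mem_univ _⟩, hτ⟩
    rintro rfl
    have h2 := hB0 τ hτ
    rw [← h1] at h2
    simp [Dum] at h2
  have hdis : Disjoint M' K := by
    rw [Finset.disjoint_left]
    intro A hA hA'
    have h1 := hKM A hA A hA'
    rw [Finset.disjoint_self_iff_empty] at h1
    have h2 := (K2 A hA').1
    rw [h1] at h2; simp at h2; omega
  have hP' : Pack H k r W (M' ∪ K) := by
    refine ⟨?_, ?_, ?_⟩
    · intro A hA C hC hne
      rcases Finset.mem_union.1 hA with hA | hA <;> rcases Finset.mem_union.1 hC with hC | hC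
      · exact hP.1 A (Finset.mem_filter.1 hA).1 C (Finset.mem_filter.1 hC).1 hne
      · exact hKM A hA C hC
      · exact (hKM C hC A hA).symm
      · exact K1 A hA C hC hne
    · intro A hA
      rcases Finset.mem_union.1 hA with hA | hA
      · exact hP.2.1 A (Finset.mem_filter.1 hA).1
      · exact K2 A hA
    · intro u hu
      obtain ⟨A, hA, huA⟩ := Finset.mem_biUnion.1 hu
      rcases Finset.mem_union.1 hA with hA | hA
      · exact hP.2.2 (Finset.mem_biUnion.2 ⟨A, (Finset.mem_filter.1 hA).1, huA⟩)
      · obtain ⟨i, τ, hτ, a, rfl⟩ := K4 A hA u huA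
        exact hvW _
  have hmax := hMmax (M' ∪ K) (Finset.mem_filter.2 ⟨Finset.mem_univ _, hP'⟩)
  rw [Finset.card_union_of_disjoint hdis] at hmax
  have e : (m - 1) * N + N = N * m := by
    obtain ⟨m', rfl⟩ : ∃ m', m = m' + 1 := ⟨m - 1, by omega⟩
    simp; ring
  generalize N * m = z at *
  generalize (m - 1) * N = z' at *
  omega

lemma finish {V : Type} [Fintype V] [DecidableEq V] (H : Finset (Finset V)) (k r t d : ℕ)
    (ι : Type) [Fintype ι] (F : Finset (ι → V))
    (hF1 : ∀ g ∈ F, ∀ g' ∈ F, g ≠ g' → Disjoint (univ.image g) (univ.image g'))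
    (hF2 : ∀ g ∈ F, Til H k r (univ.image g))
    (M : Finset (Finset V)) (hM : Pack H k r (univ \ F.biUnion (fun g => univ.image g)) M)
    (hW : (univ \ F.biUnion (fun g => univ.image g)).card = r * t) (hMd : M.card + d = t)
    (hF3 : ∀ X : Finset V, X.card = r → d ≤ (F.filter (fun g => Absb H k r X g)).card) :
    Til H k r univ := by
  set W := univ \ F.biUnion (fun g => univ.image g) with hWd
  have h1 := absorb_ind H k r d F (W \ M.biUnion id) hF1 hF2
    (fun g hg => by
      rw [Finset.disjoint_left]
      intro u hu hu'
      exact (Finset.mem_sdiff.1 (Finset.mem_sdiff.1 hu').1).2 (Finset.mem_biUnion.2 ⟨g, hg, hu⟩))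
    (by rw [Finset.card_sdiff_of_subset hM.2.2, pack_card hM, hW, ← hMd, Nat.mul_add, mul_comm r M.card,
          Nat.add_sub_cancel_left])
    (fun X _ hX => hF3 X hX)
  have h2 : Til H k r (M.biUnion id) := ⟨M, hM.1, hM.2.1, rfl⟩
  have h3 := h1.union h2 (by
    rw [Finset.disjoint_union_left]
    refine ⟨?_, Finset.sdiff_disjoint⟩
    rw [Finset.disjoint_left]
    intro u hu hu'
    exact (Finset.mem_sdiff.1 (hM.2.2 hu')).2 hu)
  convert h3 using 1
  symm
  rw [Finset.eq_univ_iff_forall]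
  intro u
  simp only [Finset.mem_union, Finset.mem_sdiff, hWd, Finset.mem_univ, true_and]
  tauto

lemma core (k r D : ℕ) (hk : 3 ≤ k) (hkr : k ≤ r)
    (hD : D = (r-1).choose (k-1) + (r-2).choose (k-2)) (α : ℝ) (hα : 0 < α) (hαD : α ≤ 1 / (2 * D)) :
    ∃ n₀ : ℕ, ∀ (V : Type) [Fintype V] [DecidableEq V] (H : Finset (Finset V)),
      n₀ ≤ Fintype.card V → r ∣ Fintype.card V →
      (∀ S : Finset V, S.card = k - 1 →
        ((univ.filter (fun v => insert v S ∉ H)).card : ℝ) ≤ (1 / D - α) * Fintype.card V) →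
      Til H k r univ := by
  have hD0 : 0 < D := by
    rw [hD]
    have := Nat.choose_pos (n := r - 1) (k := k - 1) (by omega)
    omega
  have hD1 : (1 : ℝ) ≤ D := by exact_mod_cast hD0
  have hD' : (0 : ℝ) < D := by linarith
  have hDα : D * α ≤ 1 / 2 := by
    rw [le_div_iff₀ (by positivity)] at hαD
    linarith
  have hα1 : α ≤ 1 / 2 := by nlinarith
  have hDD : (D : ℝ) * (1 / D) = 1 := by field_simp
  have hD1' : 1 / (D : ℝ) ≤ 1 := by rw [div_le_one hD']; exact hD1
  have hD2 : 2 * α ≤ 1 / (D : ℝ) := by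
    rw [le_div_iff₀ hD']; linarith
  obtain ⟨c, hc⟩ : ∃ c : ℝ, c = D * α / 2 := ⟨_, rfl⟩
  have hc0 : 0 < c := by rw [hc]; positivity
  have hc1 : c ≤ 1 := by rw [hc]; linarith
  obtain ⟨L, hL⟩ : ∃ L : ℕ, L = r * r := ⟨_, rfl⟩
  have hL1 : 1 ≤ L := by rw [hL]; nlinarith
  have hL1' : (1 : ℝ) ≤ L := by exact_mod_cast hL1
  obtain ⟨cA, hcA⟩ : ∃ cA : ℝ, cA = c ^ L / 2 := ⟨_, rfl⟩
  have hcA0 : 0 < cA := by rw [hcA]; positivity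
  have hcA1 : cA ≤ 1 := by
    have := pow_le_one₀ (n := L) hc0.le hc1
    rw [hcA]; linarith
  obtain ⟨β, hβ⟩ : ∃ β : ℝ, β = cA * α / (2 * (L:ℝ)^2) := ⟨_, rfl⟩
  have hβ0 : 0 < β := by rw [hβ]; positivity
  have hLβ : (L : ℝ)^2 * β = cA * α / 2 := by rw [hβ]; field_simp
  have hβ1 : (L : ℝ)^2 * β ≤ cA / 2 := by rw [hLβ]; nlinarith
  have hβ2 : (L : ℝ) * β ≤ α / 2 := by
    have h1 : (L : ℝ) * β ≤ (L : ℝ)^2 * β := by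
      apply mul_le_mul_of_nonneg_right _ hβ0.le
      nlinarith
    rw [hLβ] at h1
    nlinarith
  obtain ⟨γ, hγ⟩ : ∃ γ : ℝ, γ = cA * β / 8 := ⟨_, rfl⟩
  have hγ0 : 0 < γ := by rw [hγ]; positivity
  obtain ⟨b, hb⟩ : ∃ b : ℝ, b = 1 / D - α / 2 := ⟨_, rfl⟩
  obtain ⟨n₁, hn₁⟩ := selection L r cA β hcA0 hcA1 hβ0 hβ1
  obtain ⟨t₀, ht₀⟩ := almost k r D hk hkr hD b γ (by rw [hb]; linarith) (by rw [hb]; linarith) hγ0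
  refine ⟨n₁ + 2 * r * t₀ + r + 1 + ⌈((r + 2 : ℕ) : ℝ) / c⌉₊ + ⌈((L:ℝ)^2 + L * r) / cA⌉₊, ?_⟩
  intro V _ inst H hn hrn hmiss
  obtain rfl : inst = fun a b => Classical.propDecidable (a = b) := Subsingleton.elim _ _
  set n := Fintype.card V with hndef
  have hn0 : (0 : ℝ) < n := by
    have : 0 < n := by omega
    exact_mod_cast this
  have hc2 : ((r + 2 : ℕ) : ℝ) ≤ c * n := by
    have h1 : ⌈((r + 2 : ℕ) : ℝ) / c⌉₊ ≤ n := by omega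
    have h2 := (Nat.le_ceil _).trans (Nat.cast_le (α := ℝ).2 h1)
    rw [div_le_iff₀ hc0] at h2
    linarith
  have hcA2 : ((L:ℝ)^2 + L * r) ≤ cA * n := by
    have h1 : ⌈((L:ℝ)^2 + L * r) / cA⌉₊ ≤ n := by omega
    have h2 := (Nat.le_ceil _).trans (Nat.cast_le (α := ℝ).2 h1)
    rw [div_le_iff₀ hcA0] at h2
    linarith
  have hcι : Fintype.card (Fin r × Option (Fin (r - 1))) = L := by
    rw [hL]; simp; left; omega
  let A : Finset V → Finset (Fin r × Option (Fin (r - 1)) → V) := fun R =>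
    univ.filter (fun g => Absb H k r R g)
  have hA : ∀ R ∈ (univ : Finset V).powersetCard r, cA * (n : ℝ) ^ L ≤ ((A R).card : ℝ) := by
    intro R hR
    have h1 := absorber_count H k r (1 / D - α) (c * n) hk hkr (by linarith) (by positivity) hmiss
      (by
        rw [← hD, ← hndef]
        have e1 : (D : ℝ) * ((1 / D - α) * n) = n - 2 * (c * n) := by
          rw [hc]; field_simp
        rw [e1]; linarith) R (Finset.mem_powersetCard.1 hR).2
    rw [← hndef] at h1
    have e2 : ((r:ℝ) * r)  = L := by rw [hL]; push_cast; ring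
    rw [e2, ← hL, mul_pow] at h1
    have e3 : c ^ L = 2 * cA := by rw [hcA]; ring
    rw [e3] at h1
    have h2 : ((L:ℝ)^2 + L * r) * (n:ℝ)^L ≤ cA * n * (n:ℝ)^L :=
      mul_le_mul_of_nonneg_right hcA2 (by positivity)
    have h3 : cA * (n : ℝ) ^ L * n ≤ ((A R).card : ℝ) * n := by
      change _ ≤ ((univ.filter (fun g : Fin r × Option (Fin (r - 1)) → V => Absb H k r R g)).card : ℝ) * n
      linarith
    exact le_of_mul_le_mul_right h3 hn0
  haveI : Nonempty (Fin r × Option (Fin (r - 1))) := ⟨(⟨0, by omega⟩, none)⟩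
  obtain ⟨F, hF1, hF2, hF3, hF4⟩ := hn₁ (Fin r × Option (Fin (r - 1))) V (Finset V) hcι (by omega)
    ((univ : Finset V).powersetCard r)
    (Finset.powersetCard_nonempty.2 (by rw [Finset.card_univ]; omega))
    (by
      rw [Finset.card_powersetCard, Finset.card_univ]
      exact_mod_cast Nat.choose_le_pow _ _) A hA
  have hFA : ∀ g ∈ F, ∃ R, Absb H k r R g := by
    intro g hg
    obtain ⟨R, _, hR⟩ := hF2 g hg
    exact ⟨R, (Finset.mem_filter.1 hR).2⟩
  set U := F.biUnion (fun g => univ.image g) with hU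
  have hUc : U.card = L * F.card := by
    rw [hU, Finset.card_biUnion hF3, mul_comm]
    apply Finset.sum_const_nat
    intro g hg
    obtain ⟨R, hR⟩ := hFA g hg
    rw [Finset.card_image_of_injective _ hR.1, Finset.card_univ, hcι]
  have hUn : L * F.card ≤ n := by
    rw [← hUc]; exact Finset.card_le_univ U
  have hWc : (univ \ U).card = n - L * F.card := by
    rw [Finset.card_sdiff_of_subset (Finset.subset_univ _), Finset.card_univ, hUc]
  obtain ⟨t, ht⟩ : r ∣ n - L * F.card :=
    Nat.dvd_sub hrn (by rw [hL, mul_assoc]; exact Dvd.intro _ rfl)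
  have hrt : (r : ℝ) * t = n - L * F.card := by
    have : r * t + L * F.card = n := by omega
    have h2 : (r : ℝ) * t + L * F.card = n := by exact_mod_cast this
    linarith
  have hLF : (L : ℝ) * F.card ≤ α / 2 * n := by
    calc (L : ℝ) * F.card ≤ L * (β * n) := mul_le_mul_of_nonneg_left hF1 (by positivity)
      _ = L * β * n := by ring
      _ ≤ α / 2 * n := mul_le_mul_of_nonneg_right hβ2 hn0.le
  have htt : t₀ ≤ t := by
    have h1 : (2 : ℝ) * r * t₀ ≤ n := by
      have : 2 * r * t₀ ≤ n := by omega
      exact_mod_cast this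
    have h2 : (n : ℝ) ≤ 2 * (r * t) := by rw [hrt]; nlinarith
    have hr0 : (0 : ℝ) < r := by
      have : 0 < r := by omega
      exact_mod_cast this
    have h3 : (t₀ : ℝ) ≤ t := by
      refine le_of_mul_le_mul_left (a := (2 * r : ℝ)) ?_ (by positivity)
      linarith
    exact_mod_cast h3
  obtain ⟨M, hM1, hM2, hM3⟩ := ht₀ V H (univ \ U) t (by rw [hWc, ht]) htt (by
    intro S hS
    refine (hmiss S hS).trans ?_
    rw [hrt, hb]
    have hb1 : 1 / (D:ℝ) - α / 2 ≤ 1 := by linarith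
    have hb0 : 0 ≤ 1 / (D:ℝ) - α / 2 := by linarith
    have : (1 / (D:ℝ) - α / 2) * (L * F.card) ≤ α / 2 * n :=
      (mul_le_of_le_one_left (by positivity) hb1).trans hLF
    rw [mul_sub]
    linarith)
  refine finish H k r t (t - M.card) _ F hF3 (fun g hg => ?_) M hM1 (by rw [← hU, hWc, ht]) (by omega) ?_
  · obtain ⟨R, hR⟩ := hFA g hg
    exact hR.2.2.1
  · intro X hX
    have h1 := hF4 X (Finset.mem_powersetCard.2 ⟨Finset.subset_univ _, hX⟩)
    have e : F.filter (fun g => g ∈ A X) = F.filter (fun g => Absb H k r X g) := by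
      apply Finset.filter_congr
      intro g _
      simp [A]
    rw [e] at h1
    have h2 : (t : ℝ) ≤ n := by
      have hr1 : t ≤ r * t := Nat.le_mul_of_pos_left _ (by omega)
      have : t ≤ n := by omega
      exact_mod_cast this
    have h3 : ((t - M.card : ℕ) : ℝ) ≤ ((F.filter (fun g => Absb H k r X g)).card : ℝ) := by
      refine hM3.trans (le_trans ?_ h1)
      rw [← hγ]
      exact mul_le_mul_of_nonneg_left h2 hγ0.le
    exact_mod_cast h3

/-- For all `r ≥ k ≥ 3`, the asymptotic codegree tiling threshold satisfies
`t_{k-1}(K^{(k)}_r) ≤ 1 - 1/(C(r-1,k-1) + C(r-2,k-2))`: for every `α > 0` there is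
`n₀` such that every `k`-graph on `n ≥ n₀` vertices (with `r ∣ n`) of minimum
codegree at least `(1 - 1/(C(r-1,k-1)+C(r-2,k-2)) + α)·n` has a perfect matching
by `r`-cliques. -/
theorem stmt_16 (k r : ℕ) (hk : 3 ≤ k) (hkr : k ≤ r) (α : ℝ) (hα : 0 < α) :
    ∃ n₀ : ℕ, ∀ (V : Type) (_ : Fintype V) (_ : DecidableEq V) (n : ℕ),
      Fintype.card V = n → n₀ ≤ n → r ∣ n →
      ∀ H : Finset (Finset V), (∀ e ∈ H, e.card = k) →
      (∀ S : Finset V, S.card = k - 1 →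
        (1 - 1 / ((Nat.choose (r - 1) (k - 1) : ℝ) + (Nat.choose (r - 2) (k - 2) : ℝ))
          + α) * n ≤ ((H.filter (fun e => S ⊆ e)).card : ℝ)) →
      ∃ M : Finset (Finset V), M.card = n / r ∧
        (∀ A ∈ M, ∀ B ∈ M, A ≠ B → Disjoint A B) ∧
        (∀ A ∈ M, A.card = r ∧ HIsClique H k A) ∧
        M.biUnion id = Finset.univ := by
  obtain ⟨D, hD⟩ : ∃ D : ℕ, D = (r-1).choose (k-1) + (r-2).choose (k-2) := ⟨_, rfl⟩
  have hD0 : 0 < D := by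
    rw [hD]
    have := Nat.choose_pos (n := r - 1) (k := k - 1) (by omega)
    omega
  have hD' : (0 : ℝ) < D := by exact_mod_cast hD0
  have hDr : (Nat.choose (r - 1) (k - 1) : ℝ) + (Nat.choose (r - 2) (k - 2) : ℝ) = D := by
    rw [hD]; push_cast; rfl
  obtain ⟨n₀, hn₀⟩ := core k r D hk hkr hD (min α (1 / (2 * D)))
    (lt_min hα (by positivity)) (min_le_right _ _)
  refine ⟨n₀, ?_⟩
  intro V _ _ n hVn hn hrn H hH hcod
  rw [hDr] at hcod
  subst hVn
  obtain ⟨M, hM1, hM2, hM3⟩ := hn₀ V H hn hrn (by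
    intro S hS
    have h1 := hcod S hS
    have h2 : (H.filter (fun e => S ⊆ e)).card ≤ (univ.filter (fun v => insert v S ∈ H)).card := by
      have hsub : H.filter (fun e => S ⊆ e) ⊆
          (univ.filter (fun v => insert v S ∈ H)).image (fun v => insert v S) := by
        intro e he
        obtain ⟨he1, he2⟩ := Finset.mem_filter.1 he
        have hc : (e \ S).card = 1 := by
          rw [Finset.card_sdiff_of_subset he2, hH e he1, hS]; omega
        obtain ⟨v, hv⟩ := Finset.card_eq_one.1 hc
        have hins : insert v S = e := by
          rw [Finset.insert_eq, ← hv, Finset.sdiff_union_of_subset he2]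
        exact Finset.mem_image.2 ⟨v, Finset.mem_filter.2 ⟨Finset.mem_univ _, by rw [hins]; exact he1⟩, hins⟩
      exact (Finset.card_le_card hsub).trans Finset.card_image_le
    have h3 : (univ.filter (fun v => insert v S ∈ H)).card + (univ.filter (fun v => insert v S ∉ H)).card
        = Fintype.card V := by
      rw [Finset.card_filter_add_card_filter_not, Finset.card_univ]
    have h2' : ((H.filter (fun e => S ⊆ e)).card : ℝ) ≤ (univ.filter (fun v => insert v S ∈ H)).card := by
      exact_mod_cast h2
    have h3' : ((univ.filter (fun v => insert v S ∈ H)).card : ℝ) + (univ.filter (fun v => insert v S ∉ H)).card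
        = Fintype.card V := by exact_mod_cast h3
    have h4 : min α (1 / (2 * (D:ℝ))) * Fintype.card V ≤ α * Fintype.card V :=
      mul_le_mul_of_nonneg_right (min_le_left _ _) (by positivity)
    linarith)
  refine ⟨M, ?_, hM1, hM2, hM3⟩
  have h5 := pack_card (W := univ) ⟨hM1, hM2, Finset.subset_univ _⟩
  rw [hM3, Finset.card_univ] at h5
  rw [h5, Nat.mul_div_cancel _ (by omega)]
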